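/- arXiv:2605.06172 — 4 statements merged into one kernel-verified Lean document; each statement's English description precedes it below -/
import Mathlib

section
/- Let Σ ∈ ℝ^{n×n} be symmetric positive definite, let μ be a probability measure on ℝ^n whose support is contained in the closed ball of radius R centered at the origin, and let p_H(x) = ∫ φ_Σ(x − y) dμ(y). Set λ_* = min(1, λ_min(Σ)), where λ_min(Σ) is the smallest eigenvalue of Σ. Then for every t ≥ 0 the VP marginal p_t is strictly positive, log p_t is twice differentiable, and for all x ∈ ℝ^n the operator norm of the Hessian satisfies ‖∇² log p_t(x)‖ ≤ 1/λ_* + R²/λ_*². In particular, sup_{t∈[0,T]} sup_{x∈ℝ^n} ‖∇² log p_t(x)‖ < ∞ for every T > 0. -/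
open MeasureTheory Real Filter Set
open scoped ENNReal Topology RealInnerProductSpace Classical

noncomputable section

/-- Gaussian density kernel with covariance `s2 • I`. -/
def gaussKernel (n : ℕ) (s2 : ℝ) (z : EuclideanSpace ℝ (Fin n)) : ℝ :=
  (2 * π * s2) ^ (-(n : ℝ) / 2) * Real.exp (-‖z‖ ^ 2 / (2 * s2))

/-- VP diffusion marginal `p_t`, with `p_0 = p_H`. -/
def vpMarginal (n : ℕ) (pH : EuclideanSpace ℝ (Fin n) → ℝ) (t : ℝ)
    (x : EuclideanSpace ℝ (Fin n)) : ℝ :=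
  if t = 0 then pH x
  else ∫ y, pH y * gaussKernel n (1 - Real.exp (-t)) (x - Real.exp (-t / 2) • y)

/-- The measure with Lebesgue density `p`. -/
def densMeasure (n : ℕ) (p : EuclideanSpace ℝ (Fin n) → ℝ) :
    Measure (EuclideanSpace ℝ (Fin n)) :=
  volume.withDensity fun x => ENNReal.ofReal (p x)

/-- The standard Gaussian measure `γ_n`. -/
def stdGaussian (n : ℕ) : Measure (EuclideanSpace ℝ (Fin n)) :=
  densMeasure n (gaussKernel n 1)

/-- Score function `s_t = ∇ log p_t`. -/
def score (n : ℕ) (pH : EuclideanSpace ℝ (Fin n) → ℝ) (t : ℝ)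
    (x : EuclideanSpace ℝ (Fin n)) : EuclideanSpace ℝ (Fin n) :=
  gradient (fun z => Real.log (vpMarginal n pH t z)) x

/-- Probability-flow vector field `v_t(x) = -x/2 - s_t(x)/2`. -/
def vField (n : ℕ) (pH : EuclideanSpace ℝ (Fin n) → ℝ) (t : ℝ)
    (x : EuclideanSpace ℝ (Fin n)) : EuclideanSpace ℝ (Fin n) :=
  -(2 : ℝ)⁻¹ • x - (2 : ℝ)⁻¹ • score n pH t x

/-- `φ` is a flow map of `v` from time `s` to time `T`. -/
def IsFlowMap (n : ℕ)
    (v : ℝ → EuclideanSpace ℝ (Fin n) → EuclideanSpace ℝ (Fin n)) (s T : ℝ)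
    (φ : EuclideanSpace ℝ (Fin n) → EuclideanSpace ℝ (Fin n)) : Prop :=
  ∀ x, ∃ γ : ℝ → EuclideanSpace ℝ (Fin n),
    γ s = x ∧ (∀ t ∈ Set.Icc s T, HasDerivAt γ (v t (γ t)) t) ∧ γ T = φ x

/-- Total variation norm `‖μ - ν‖_TV` of the difference of two finite measures. -/
def tvDist {α : Type*} [MeasurableSpace α] (μ ν : Measure α) : ℝ≥0∞ :=
  (⨆ (s : Set α) (_ : MeasurableSet s), μ s - ν s) +
    (⨆ (s : Set α) (_ : MeasurableSet s), ν s - μ s)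

/-- Kullback–Leibler divergence. -/
def klDiv {α : Type*} [MeasurableSpace α] (μ ν : Measure α) : ℝ≥0∞ :=
  if μ ≪ ν ∧ Integrable (llr μ ν) μ then ENNReal.ofReal (∫ x, llr μ ν x ∂μ) else ⊤

/-- A real function is twice differentiable. -/
def TwiceDiff {E : Type*} [NormedAddCommGroup E] [NormedSpace ℝ E] (f : E → ℝ) : Prop :=
  Differentiable ℝ f ∧ Differentiable ℝ (fderiv ℝ f)

/-- Hessian of a real function as a continuous bilinear map. -/
def hessian {E : Type*} [NormedAddCommGroup E] [NormedSpace ℝ E] (f : E → ℝ) (x : E) :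
    E →L[ℝ] E →L[ℝ] ℝ :=
  fderiv ℝ (fderiv ℝ f) x

/-- A map is bi-Lipschitz. -/
def BiLipschitz {E : Type*} [NormedAddCommGroup E] (φ : E → E) : Prop :=
  ∃ c C : ℝ, 0 < c ∧ c ≤ C ∧
    ∀ x y, c * ‖x - y‖ ≤ ‖φ x - φ y‖ ∧ ‖φ x - φ y‖ ≤ C * ‖x - y‖

/-- Centered Gaussian density with covariance matrix `S`. -/
def gaussMat (n : ℕ) (S : Matrix (Fin n) (Fin n) ℝ) (z : EuclideanSpace ℝ (Fin n)) : ℝ :=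
  ((2 * π) ^ n * S.det) ^ (-(1 : ℝ) / 2) *
    Real.exp (-(∑ i, z i * S⁻¹.mulVec (fun j => z j) i) / 2)

end

section helpers
set_option maxSynthPendingDepth 6
set_option linter.unusedSectionVars false
variable {V : Type*} [NormedAddCommGroup V] [InnerProductSpace ℝ V] [FiniteDimensional ℝ V]
  [MeasurableSpace V] [BorelSpace V]

lemma aux_smulRight_cont {G : Type*} [NormedAddCommGroup G] [NormedSpace ℝ G]
    {T : V → V} (hT : Continuous T) {F : V → G} (hF : Continuous F) :
    Continuous (fun y => (innerSL ℝ (T y)).smulRight (F y)) := by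
  have : (fun y => (innerSL ℝ (T y)).smulRight (F y)) =
      fun y => ContinuousLinearMap.smulRightL ℝ V G (innerSL ℝ (T y)) (F y) := rfl
  rw [this]
  fun_prop

lemma aux_integrable {G : Type*} [NormedAddCommGroup G] [NormedSpace ℝ G]
    (ν : Measure V) [IsFiniteMeasure ν]
    {T : V → V} (hT : Continuous T) {F : V → G} (hF : Continuous F) {r C : ℝ}
    (hTr : ∀ᵐ y ∂ν, ‖T y‖ ≤ r) (hFC : ∀ᵐ y ∂ν, ‖F y‖ ≤ C) (x : V) :
    Integrable (fun y => Real.exp ⟪T y, x⟫ • F y) ν := by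
  refine Integrable.of_bound (C := Real.exp (r * ‖x‖) * C)
    (Continuous.aestronglyMeasurable (by fun_prop)) ?_
  filter_upwards [hTr, hFC] with y h1 h2
  rw [norm_smul, Real.norm_of_nonneg (Real.exp_pos _).le]
  refine mul_le_mul ?_ h2 (norm_nonneg _) (Real.exp_pos _).le
  refine Real.exp_le_exp.2 ((real_inner_le_norm _ _).trans ?_)
  gcongr

lemma aux_hasFDerivAt {G : Type*} [NormedAddCommGroup G] [NormedSpace ℝ G]
    (ν : Measure V) [IsFiniteMeasure ν]
    {T : V → V} (hT : Continuous T) {F : V → G} (hF : Continuous F) {r C : ℝ}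
    (hTr : ∀ᵐ y ∂ν, ‖T y‖ ≤ r) (hFC : ∀ᵐ y ∂ν, ‖F y‖ ≤ C) (x : V) :
    HasFDerivAt (fun x => ∫ y, Real.exp ⟪T y, x⟫ • F y ∂ν)
      (∫ y, Real.exp ⟪T y, x⟫ • (innerSL ℝ (T y)).smulRight (F y) ∂ν) x := by
  have hc := aux_smulRight_cont hT hF
  refine hasFDerivAt_integral_of_dominated_of_fderiv_le (s := Metric.ball x 1)
    (F := fun x y => Real.exp ⟪T y, x⟫ • F y)
    (F' := fun x y => Real.exp ⟪T y, x⟫ • (innerSL ℝ (T y)).smulRight (F y))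
    (bound := fun _ => Real.exp (r * (‖x‖ + 1)) * (r * C))
    (Metric.ball_mem_nhds _ one_pos) ?_ (aux_integrable ν hT hF hTr hFC x) ?_ ?_
    (integrable_const _) ?_
  · exact Eventually.of_forall fun z => Continuous.aestronglyMeasurable (by fun_prop)
  · exact Continuous.aestronglyMeasurable (by fun_prop)
  · filter_upwards [hTr, hFC] with y h1 h2 z hz
    have hr : 0 ≤ r := (norm_nonneg _).trans h1
    have hz' : ‖z‖ ≤ ‖x‖ + 1 := by
      have := mem_ball_iff_norm.1 hz
      have h3 : ‖z‖ ≤ ‖z - x‖ + ‖x‖ := by simpa using norm_add_le (z - x) x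
      linarith
    rw [norm_smul, Real.norm_of_nonneg (Real.exp_pos _).le, ContinuousLinearMap.norm_smulRight_apply,
      innerSL_apply_norm]
    refine mul_le_mul ?_ (mul_le_mul h1 h2 (norm_nonneg _) hr) (by positivity) (Real.exp_pos _).le
    refine Real.exp_le_exp.2 ((real_inner_le_norm _ _).trans ?_)
    gcongr
  · refine Eventually.of_forall fun y z _ => ?_
    have h := ((innerSL ℝ (T y)).hasFDerivAt (x := z)).exp.smul_const (F y)
    refine h.congr_fderiv ?_
    ext w
    simp [mul_smul]

/-- Log-Laplace transforms of compactly supported measures. -/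
lemma aux_logLaplace (ν : Measure V) [IsProbabilityMeasure ν]
    {T : V → V} (hT : Continuous T) {w : V → ℝ} (hw : Continuous w) {r : ℝ}
    (hTr : ∀ᵐ y ∂ν, ‖T y‖ ≤ r) (hw0 : ∀ y, 0 < w y) (hw1 : ∀ y, w y ≤ 1) :
    (∀ x, 0 < ∫ y, Real.exp ⟪T y, x⟫ * w y ∂ν) ∧
    TwiceDiff (fun x => Real.log (∫ y, Real.exp ⟪T y, x⟫ * w y ∂ν)) ∧
    ∀ x, ‖hessian (fun x => Real.log (∫ y, Real.exp ⟪T y, x⟫ * w y ∂ν)) x‖ ≤ r ^ 2 := by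
  have hr : 0 ≤ r := by
    obtain ⟨y, hy⟩ := hTr.exists
    exact (norm_nonneg _).trans hy
  set F1 : V → V →L[ℝ] ℝ := fun y => (innerSL ℝ (T y)).smulRight (w y) with hF1
  set F2 : V → V →L[ℝ] V →L[ℝ] ℝ := fun y => (innerSL ℝ (T y)).smulRight (F1 y) with hF2
  have hF1c : Continuous F1 := aux_smulRight_cont hT hw
  have hF2c : Continuous F2 := aux_smulRight_cont hT hF1c
  have hwb : ∀ᵐ y ∂ν, ‖w y‖ ≤ 1 := Eventually.of_forall fun y => by
    rw [Real.norm_of_nonneg (hw0 y).le]; exact hw1 y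
  have hF1b : ∀ᵐ y ∂ν, ‖F1 y‖ ≤ r * 1 := by
    filter_upwards [hTr, hwb] with y h1 h2
    simp only [hF1]
    rw [ContinuousLinearMap.norm_smulRight_apply, innerSL_apply_norm]
    gcongr
  have hF2b : ∀ᵐ y ∂ν, ‖F2 y‖ ≤ r * (r * 1) := by
    filter_upwards [hTr, hF1b] with y h1 h2
    simp only [hF2]
    rw [ContinuousLinearMap.norm_smulRight_apply, innerSL_apply_norm]
    gcongr
  set M : V → ℝ := fun x => ∫ y, Real.exp ⟪T y, x⟫ * w y ∂ν with hM
  set M1 : V → V →L[ℝ] ℝ := fun x => ∫ y, Real.exp ⟪T y, x⟫ • F1 y ∂ν with hM1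
  set M2 : V → V →L[ℝ] V →L[ℝ] ℝ := fun x => ∫ y, Real.exp ⟪T y, x⟫ • F2 y ∂ν with hM2
  have iM : ∀ x, Integrable (fun y => Real.exp ⟪T y, x⟫ * w y) ν :=
    fun x => aux_integrable ν hT hw hTr hwb x
  have iM1 : ∀ x, Integrable (fun y => Real.exp ⟪T y, x⟫ • F1 y) ν :=
    fun x => aux_integrable ν hT hF1c hTr hF1b x
  have iM2 : ∀ x, Integrable (fun y => Real.exp ⟪T y, x⟫ • F2 y) ν :=
    fun x => aux_integrable ν hT hF2c hTr hF2b x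
  have dM : ∀ x, HasFDerivAt M (M1 x) x := fun x => aux_hasFDerivAt ν hT hw hTr hwb x
  have dM1 : ∀ x, HasFDerivAt M1 (M2 x) x := fun x => aux_hasFDerivAt ν hT hF1c hTr hF1b x
  have hpos : ∀ x, 0 < M x := by
    intro x
    refine (integral_pos_iff_support_of_nonneg
      (fun y => (mul_pos (Real.exp_pos _) (hw0 y)).le) (iM x)).2 ?_
    have : Function.support (fun y => Real.exp ⟪T y, x⟫ * w y) = Set.univ := by
      ext y; simp [(hw0 y).ne']
    rw [this]; simp
  have dL : ∀ x, HasFDerivAt (fun x => Real.log (M x)) ((M x)⁻¹ • M1 x) x :=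
    fun x => (dM x).log (hpos x).ne'
  have eL : fderiv ℝ (fun x => Real.log (M x)) = fun x => (M x)⁻¹ • M1 x :=
    funext fun x => (dL x).fderiv
  have dL1 : ∀ x, HasFDerivAt (fun x => (M x)⁻¹ • M1 x)
      ((M x)⁻¹ • M2 x + ((-(M x ^ 2)⁻¹) • M1 x).smulRight (M1 x)) x := fun x =>
    HasFDerivAt.smul ((hasDerivAt_inv (hpos x).ne').comp_hasFDerivAt x (dM x)) (dM1 x)
  have e1 : ∀ x u, M1 x u = ∫ y, (Real.exp ⟪T y, x⟫ * w y) * ⟪T y, u⟫ ∂ν := by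
    intro x u
    rw [hM1]
    simp only
    rw [ContinuousLinearMap.integral_apply (iM1 x)]
    refine integral_congr_ae (Eventually.of_forall fun y => ?_)
    simp [hF1]; ring
  have e2 : ∀ x u v, M2 x u v =
      ∫ y, (Real.exp ⟪T y, x⟫ * w y) * (⟪T y, u⟫ * ⟪T y, v⟫) ∂ν := by
    intro x u v
    rw [hM2]
    simp only
    rw [ContinuousLinearMap.integral_apply (iM2 x), ContinuousLinearMap.integral_apply]
    · refine integral_congr_ae (Eventually.of_forall fun y => ?_)
      simp [hF1, hF2]; ring
    · exact (iM2 x).apply_continuousLinearMap u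
  have i1 : ∀ x u, Integrable (fun y => (Real.exp ⟪T y, x⟫ * w y) * ⟪T y, u⟫) ν := by
    intro x u
    refine ((iM1 x).apply_continuousLinearMap u).congr (Eventually.of_forall fun y => ?_)
    simp [hF1]; ring
  have i2 : ∀ x u v, Integrable
      (fun y => (Real.exp ⟪T y, x⟫ * w y) * (⟪T y, u⟫ * ⟪T y, v⟫)) ν := by
    intro x u v
    refine (((iM2 x).apply_continuousLinearMap u).apply_continuousLinearMap v).congr
      (Eventually.of_forall fun y => ?_)
    simp [hF1, hF2]; ring
  refine ⟨hpos, ⟨fun x => (dL x).differentiableAt, ?_⟩, ?_⟩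
  · rw [eL]; exact fun x => (dL1 x).differentiableAt
  intro x
  have eH : hessian (fun x => Real.log (M x)) x =
      (M x)⁻¹ • M2 x + ((-(M x ^ 2)⁻¹) • M1 x).smulRight (M1 x) := by
    unfold hessian; rw [eL]; exact (dL1 x).fderiv
  rw [eH]
  set B := (M x)⁻¹ • M2 x + ((-(M x ^ 2)⁻¹) • M1 x).smulRight (M1 x) with hB
  have hBe : ∀ u v, B u v = (M x)⁻¹ * M2 x u v - (M x ^ 2)⁻¹ * M1 x u * M1 x v := by
    intro u v; simp [hB]; ring
  have hm := hpos x
  have hsymm : ∀ u v, B u v = B v u := by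
    intro u v
    have : M2 x u v = M2 x v u := by
      rw [e2, e2]; congr 1; ext y; ring
    rw [hBe, hBe, this]; ring
  have hnn : ∀ u, 0 ≤ B u u := by
    intro u
    set c := (M x)⁻¹ * M1 x u with hc
    have h0 : 0 ≤ ∫ y, (Real.exp ⟪T y, x⟫ * w y) * (⟪T y, u⟫ - c) ^ 2 ∂ν :=
      integral_nonneg fun y => mul_nonneg (mul_pos (Real.exp_pos _) (hw0 y)).le (sq_nonneg _)
    have h1 : ∫ y, (Real.exp ⟪T y, x⟫ * w y) * (⟪T y, u⟫ - c) ^ 2 ∂ν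
        = M2 x u u - (2 * c) * M1 x u + c ^ 2 * M x := by
      have j : Integrable (fun y => (Real.exp ⟪T y, x⟫ * w y) * (⟪T y, u⟫ * ⟪T y, u⟫) -
          2 * c * ((Real.exp ⟪T y, x⟫ * w y) * ⟪T y, u⟫)) ν :=
        (i2 x u u).sub ((i1 x u).const_mul _)
      rw [e2, e1, hM, ← integral_const_mul, ← integral_const_mul, ← integral_sub (i2 x u u)
        ((i1 x u).const_mul _), ← integral_add j ((iM x).const_mul _)]
      congr 1; ext y; ring
    rw [h1] at h0
    have h2 : B u u = (M x)⁻¹ * (M2 x u u - (2 * c) * M1 x u + c ^ 2 * M x) := by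
      rw [hBe, hc]; field_simp; ring
    rw [h2]; positivity
  have hle : ∀ u, B u u ≤ r ^ 2 * ‖u‖ ^ 2 := by
    intro u
    have h1 : M2 x u u ≤ r ^ 2 * ‖u‖ ^ 2 * M x := by
      rw [e2, hM, ← integral_const_mul]
      refine integral_mono_ae (i2 x u u) ((iM x).const_mul _) ?_
      filter_upwards [hTr] with y hy
      have h3 : |⟪T y, u⟫| ≤ r * ‖u‖ := (abs_real_inner_le_norm _ _).trans (by gcongr)
      have h4 : ⟪T y, u⟫ * ⟪T y, u⟫ ≤ r ^ 2 * ‖u‖ ^ 2 := by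
        have := sq_le_sq' (abs_le.1 h3).1 (abs_le.1 h3).2
        nlinarith
      have h5 := (mul_pos (Real.exp_pos ⟪T y, x⟫) (hw0 y)).le
      nlinarith
    rw [hBe]
    have h2 : 0 ≤ (M x ^ 2)⁻¹ * M1 x u * M1 x u := by
      rw [mul_assoc]; exact mul_nonneg (by positivity) (mul_self_nonneg _)
    have h3 : (M x)⁻¹ * M2 x u u ≤ (M x)⁻¹ * (r ^ 2 * ‖u‖ ^ 2 * M x) := by gcongr
    have h4 : (M x)⁻¹ * (r ^ 2 * ‖u‖ ^ 2 * M x) = r ^ 2 * ‖u‖ ^ 2 := by field_simp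
    linarith
  refine ContinuousLinearMap.opNorm_le_bound₂ _ (by positivity) fun u v => ?_
  have hcs := LinearMap.BilinForm.apply_mul_apply_le_of_forall_zero_le
    (LinearMap.mk₂ ℝ (fun u v => B u v) (by simp) (by simp) (by simp) (by simp)) hnn u v
  simp only [LinearMap.mk₂_apply] at hcs
  rw [hsymm v u] at hcs
  rw [Real.norm_eq_abs]
  refine abs_le_of_sq_le_sq ?_ (by positivity)
  calc (B u v) ^ 2 = B u v * B u v := by ring
    _ ≤ B u u * B v v := hcs
    _ ≤ (r ^ 2 * ‖u‖ ^ 2) * (r ^ 2 * ‖v‖ ^ 2) :=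
      mul_le_mul (hle u) (hle v) (hnn v) (by positivity)
    _ = _ := by ring

end helpers
section helpers2
set_option maxSynthPendingDepth 6
set_option linter.unusedSectionVars false
variable {V : Type*} [NormedAddCommGroup V] [InnerProductSpace ℝ V] [FiniteDimensional ℝ V]
  [MeasurableSpace V] [BorelSpace V]

/-- Inverse of a coercive operator. -/
lemma aux_inverse (P : V →L[ℝ] V) {l : ℝ} (hl : 0 < l)
    (hP : ∀ v, l * ‖v‖ ^ 2 ≤ ⟪P v, v⟫) :
    ∃ A : V →L[ℝ] V, ∀ u, P (A u) = u := by
  have hinj : Function.Injective (P : V →ₗ[ℝ] V) := by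
    rw [injective_iff_map_eq_zero]
    intro v hv
    have h := hP v
    have hv' : P v = 0 := hv
    rw [hv', inner_zero_left] at h
    have : ‖v‖ ^ 2 = 0 := le_antisymm (by nlinarith) (sq_nonneg _)
    simpa using this
  refine ⟨LinearMap.toContinuousLinearMap
    ((LinearEquiv.ofInjectiveEndo (P : V →ₗ[ℝ] V) hinj).symm : V →ₗ[ℝ] V), fun u => ?_⟩
  exact (LinearEquiv.ofInjectiveEndo (P : V →ₗ[ℝ] V) hinj).apply_symm_apply u

lemma aux_inv_props (P A : V →L[ℝ] V) {l : ℝ} (hl : 0 < l)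
    (hsymm : ∀ u v, ⟪P u, v⟫ = ⟪u, P v⟫)
    (hP : ∀ v, l * ‖v‖ ^ 2 ≤ ⟪P v, v⟫) (hA : ∀ u, P (A u) = u) :
    (∀ u v, ⟪A u, v⟫ = ⟪u, A v⟫) ∧ (∀ u, 0 ≤ ⟪u, A u⟫) ∧ ∀ u, ‖A u‖ ≤ 1 / l * ‖u‖ := by
  refine ⟨fun u v => ?_, fun u => ?_, fun u => ?_⟩
  · calc ⟪A u, v⟫ = ⟪A u, P (A v)⟫ := by rw [hA]
      _ = ⟪u, A v⟫ := by rw [← hsymm, hA]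
  · have h := hP (A u)
    rw [hA] at h
    exact le_trans (by positivity) h
  · have h := hP (A u)
    rw [hA] at h
    have h2 := real_inner_le_norm u (A u)
    rcases (norm_nonneg (A u)).eq_or_lt with h0 | h0
    · rw [← h0]; positivity
    · rw [one_div, inv_mul_eq_div, le_div_iff₀ hl]
      have : (‖A u‖ * l) * ‖A u‖ ≤ ‖u‖ * ‖A u‖ := by nlinarith
      exact le_of_mul_le_mul_right this h0

/-- Hessian bound for a Gaussian mixture. -/
lemma aux_mixture (ν : Measure V) [IsProbabilityMeasure ν] (A : V →L[ℝ] V) {K R a C : ℝ}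
    (hK : 0 ≤ K) (ha0 : 0 ≤ a) (ha1 : a ≤ 1) (hC : 0 < C)
    (hsymm : ∀ u v, ⟪A u, v⟫ = ⟪u, A v⟫) (hnn : ∀ u, 0 ≤ ⟪u, A u⟫)
    (hA : ∀ u, ‖A u‖ ≤ K * ‖u‖) (hR : ∀ᵐ y ∂ν, ‖y‖ ≤ R) (p : V → ℝ)
    (hp : ∀ x, p x = C * ∫ y, Real.exp (-⟪x - a • y, A (x - a • y)⟫ / 2) ∂ν) :
    (∀ x, 0 < p x) ∧ TwiceDiff (fun x => Real.log (p x)) ∧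
      ∀ x, ‖hessian (fun x => Real.log (p x)) x‖ ≤ K + K ^ 2 * R ^ 2 := by
  set T : V → V := fun y => a • A y with hT
  set w : V → ℝ := fun y => Real.exp (-(a ^ 2 * ⟪y, A y⟫) / 2) with hw
  have hTr : ∀ᵐ y ∂ν, ‖T y‖ ≤ K * R := by
    filter_upwards [hR] with y hy
    simp only [hT]
    rw [norm_smul, Real.norm_of_nonneg ha0]
    calc a * ‖A y‖ ≤ 1 * (K * R) := by
          refine mul_le_mul ha1 ((hA y).trans (by gcongr)) (norm_nonneg _) zero_le_one
      _ = K * R := one_mul _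
  obtain ⟨h1, h2, h3⟩ := aux_logLaplace ν (T := T) (w := w) (by fun_prop) (by fun_prop) hTr
    (fun y => Real.exp_pos _) (fun y => by
      simp only [hw]
      rw [Real.exp_le_one_iff]
      have := mul_nonneg (sq_nonneg a) (hnn y)
      linarith)
  set M : V → ℝ := fun x => ∫ y, Real.exp ⟪T y, x⟫ * w y ∂ν with hM
  have hpM : ∀ x, p x = C * Real.exp (-⟪x, A x⟫ / 2) * M x := by
    intro x
    rw [hp, mul_assoc, hM]
    congr 1
    rw [← integral_const_mul]
    congr 1; ext y
    rw [← Real.exp_add, ← Real.exp_add]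
    congr 1
    have e : ⟪y, A x⟫ = ⟪A y, x⟫ := (hsymm y x).symm
    have e' : ⟪x, A y⟫ = ⟪A y, x⟫ := real_inner_comm _ _
    simp only [hT, map_sub, map_smul, inner_sub_left, inner_sub_right, inner_smul_left,
      inner_smul_right, e, e', RCLike.conj_to_real]
    ring
  set q : V → V →L[ℝ] ℝ := fun x => -(innerSL ℝ (A x)) with hq
  set Q : V →L[ℝ] V →L[ℝ] ℝ := -((innerSL ℝ).comp A) with hQ
  have hlog : (fun x => Real.log (p x)) =
      fun x => (Real.log C + (-⟪x, A x⟫ / 2)) + Real.log (M x) := by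
    ext x
    rw [hpM, Real.log_mul (by positivity) (h1 x).ne', Real.log_mul hC.ne' (Real.exp_pos _).ne',
      Real.log_exp]
  have dq : ∀ x, HasFDerivAt (fun x => Real.log C + (-⟪x, A x⟫ / 2)) (Q x) x := by
    intro x
    have h := (((hasFDerivAt_id x).inner ℝ (A.hasFDerivAt (x := x))).neg.mul_const
      (2⁻¹ : ℝ)).const_add (Real.log C)
    refine (h.congr_fderiv ?_)
    ext v
    have e' : ⟪v, A x⟫ = ⟪A x, v⟫ := real_inner_comm _ _
    simp [hQ, fderivInnerCLM_apply, ← hsymm x v, e']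
    ring
  have dL : ∀ x, HasFDerivAt (fun x => Real.log (p x))
      (Q x + fderiv ℝ (fun x => Real.log (M x)) x) x := by
    intro x
    rw [hlog]
    exact (dq x).add (h2.1 x).hasFDerivAt
  have eL : fderiv ℝ (fun x => Real.log (p x)) =
      fun x => Q x + fderiv ℝ (fun x => Real.log (M x)) x := funext fun x => (dL x).fderiv
  have dL2 : ∀ x, HasFDerivAt (fderiv ℝ (fun x => Real.log (p x)))
      (Q + hessian (fun x => Real.log (M x)) x) x := by
    intro x
    rw [eL]
    exact (Q.hasFDerivAt).add (h2.2 x).hasFDerivAt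
  refine ⟨fun x => ?_, ⟨fun x => (dL x).differentiableAt, fun x => (dL2 x).differentiableAt⟩,
    fun x => ?_⟩
  · rw [hpM]; have := h1 x; positivity
  · have : hessian (fun x => Real.log (p x)) x = Q + hessian (fun x => Real.log (M x)) x :=
      (dL2 x).fderiv
    rw [this]
    refine (norm_add_le _ _).trans (add_le_add ?_ ((h3 x).trans (by rw [mul_pow])))
    refine ContinuousLinearMap.opNorm_le_bound₂ _ hK fun u v => ?_
    simp only [hQ]
    simp only [neg_apply, ContinuousLinearMap.comp_apply, innerSL_apply_apply,
      norm_neg]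
    exact (norm_inner_le_norm _ _).trans (by gcongr; exact hA u)

lemma aux_gauss_integrable {b : ℝ} (hb : 0 < b) :
    Integrable (fun v : V => Real.exp (-b * ‖v‖ ^ 2)) := by
  have h := (GaussianFourier.integrable_cexp_neg_mul_sq_norm_add (b := (b : ℂ)) (V := V)
    (by simpa using hb) 0 0).norm
  refine h.congr (Eventually.of_forall fun v => ?_)
  simp only [Complex.norm_exp]
  congr 1
  simp [← Complex.ofReal_pow]

/-- Gaussian convolution (completing the square). -/
lemma aux_conv (Sg B A : V →L[ℝ] V) {a s : ℝ} (ha : 0 < a) (hs : 0 < s)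
    (hBs : ∀ u v, ⟪B u, v⟫ = ⟪u, B v⟫) (hBn : ∀ u, 0 ≤ ⟪u, B u⟫)
    (hBS : ∀ u, B (Sg u) = u)
    (hA : ∀ u, s • A u + a ^ 2 • Sg (A u) = u) :
    ∃ K > 0, ∀ x y : V,
      ∫ z, Real.exp (-⟪z - y, B (z - y)⟫ / 2) * Real.exp (-‖x - a • z‖ ^ 2 / (2 * s)) =
        K * Real.exp (-⟪x - a • y, A (x - a • y)⟫ / 2) := by
  refine ⟨∫ z : V, Real.exp (-(⟪z, B z⟫ + a ^ 2 / s * ‖z‖ ^ 2) / 2), ?_, fun x y => ?_⟩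
  · refine integral_exp_pos ?_
    have hb : 0 < a ^ 2 / s / 2 := by positivity
    refine (aux_gauss_integrable (V := V) hb).mono'
      (Continuous.aestronglyMeasurable (by fun_prop)) (Eventually.of_forall fun z => ?_)
    rw [Real.norm_of_nonneg (Real.exp_pos _).le]
    refine Real.exp_le_exp.2 ?_
    have := hBn z
    linarith
  · set u := x - a • y with hu
    set g := A u with hg
    set m := a • Sg g with hm
    rw [← integral_sub_right_eq_self
      (fun z : V => Real.exp (-(⟪z, B z⟫ + a ^ 2 / s * ‖z‖ ^ 2) / 2)) (y + m), ← integral_mul_const]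
    congr 1; ext z
    rw [← Real.exp_add, ← Real.exp_add]
    congr 1
    set k := z - (y + m) with hk
    have e1 : z - y = k + m := by rw [hk]; abel
    have e2 : x - a • z = u - a • (k + m) := by rw [hk, hu]; module
    have e3 : u = s • g + a • m := by
      rw [hm, smul_smul, ← sq]; exact (hA u).symm
    have e4 : B m = a • g := by rw [hm, map_smul, hBS]
    have e5 : u - a • (k + m) = s • g - a • k := by rw [e3]; module
    have e6 : ⟪m, B k⟫ = a * ⟪g, k⟫ := by
      rw [← hBs, e4, inner_smul_left]; simp
    have e7 : ⟪k, g⟫ = ⟪g, k⟫ := real_inner_comm _ _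
    have e8 : ⟪u, g⟫ = s * ‖g‖ ^ 2 + a * ⟪m, g⟫ := by
      rw [e3, inner_add_left, inner_smul_left, inner_smul_left, real_inner_self_eq_norm_sq]; simp
    have e9 : ⟪s • g, k⟫ = s * ⟪g, k⟫ := by rw [inner_smul_left]; simp
    have e10 : ⟪g, m⟫ = ⟪m, g⟫ := real_inner_comm _ _
    clear_value m
    rw [e1, e2, e5, e8, norm_sub_sq_real, norm_smul, norm_smul, mul_pow, mul_pow, map_add,
      inner_add_left, inner_add_right, inner_add_right, e4, e6, inner_smul_right,
      inner_smul_right, inner_smul_right, e9, e7]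
    simp only [Real.norm_eq_abs, sq_abs, RCLike.conj_to_real]
    field_simp
    ring

end helpers2
section helpers3

lemma aux_mat_symm {n : ℕ} {S : Matrix (Fin n) (Fin n) ℝ} (hS : S.IsHermitian)
    (u v : EuclideanSpace ℝ (Fin n)) :
    ⟪Matrix.toEuclideanCLM (𝕜 := ℝ) S u, v⟫ = ⟪u, Matrix.toEuclideanCLM (𝕜 := ℝ) S v⟫ := by
  have h : IsSelfAdjoint (Matrix.toEuclideanCLM (𝕜 := ℝ) S) := by
    rw [IsSelfAdjoint, ← map_star]
    congr 1
  exact (ContinuousLinearMap.isSelfAdjoint_iff_isSymmetric.1 h) u v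

lemma aux_mat_lower {n : ℕ} {S : Matrix (Fin n) (Fin n) ℝ} (hS : S.IsHermitian) {l : ℝ}
    (hl : ∀ i, l ≤ hS.eigenvalues i) (v : EuclideanSpace ℝ (Fin n)) :
    l * ‖v‖ ^ 2 ≤ ⟪Matrix.toEuclideanCLM (𝕜 := ℝ) S v, v⟫ := by
  set b := hS.eigenvectorBasis with hb
  rw [← real_inner_self_eq_norm_sq, ← b.sum_inner_mul_inner v v, ← b.sum_inner_mul_inner _ v,
    Finset.mul_sum]
  refine Finset.sum_le_sum fun i _ => ?_
  have h : Matrix.toEuclideanCLM (𝕜 := ℝ) S (b i) = hS.eigenvalues i • b i := by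
    ext j
    have := congrFun (hS.mulVec_eigenvectorBasis i) j
    simpa using this
  rw [aux_mat_symm hS, h, inner_smul_right, real_inner_comm v (b i), mul_assoc]
  exact mul_le_mul_of_nonneg_right (hl i) (mul_self_nonneg _)

lemma aux_gaussMat (n : ℕ) (S : Matrix (Fin n) (Fin n) ℝ) (z : EuclideanSpace ℝ (Fin n)) :
    gaussMat n S z = ((2 * π) ^ n * S.det) ^ (-(1 : ℝ) / 2) *
      Real.exp (-⟪z, Matrix.toEuclideanCLM (𝕜 := ℝ) S⁻¹ z⟫ / 2) := by
  unfold gaussMat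
  congr 4
  rw [PiLp.inner_apply]
  refine Finset.sum_congr rfl fun i _ => ?_
  simp [mul_comm]

end helpers3

/-- Lemma (Gaussian convolutions): for `p_H = φ_Σ ∗ μ` with `μ` supported in the closed ball
of radius `R`, the VP score is uniformly Lipschitz on `[0,T] × ℝⁿ`, with explicit bound
`1/λ⁎ + R²/λ⁎²` where `λ⁎ = min(1, λ_min(Σ))`. -/
theorem stmt_6 (n : ℕ) (hn : 0 < n) (S : Matrix (Fin n) (Fin n) ℝ) (hS : S.PosDef)
    (R : ℝ) (μ : Measure (EuclideanSpace ℝ (Fin n))) [IsProbabilityMeasure μ]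
    (hsupp : μ (Metric.closedBall 0 R)ᶜ = 0)
    (pH : EuclideanSpace ℝ (Fin n) → ℝ)
    (hpH : ∀ x, pH x = ∫ y, gaussMat n S (x - y) ∂μ)
    (lam : ℝ) (hlam : lam = min 1 (⨅ i, hS.1.eigenvalues i)) :
    (∀ t ≥ (0 : ℝ),
      (∀ x, 0 < vpMarginal n pH t x) ∧
      TwiceDiff (fun x => Real.log (vpMarginal n pH t x)) ∧
      ∀ x, ‖hessian (fun z => Real.log (vpMarginal n pH t z)) x‖ ≤
        1 / lam + R ^ 2 / lam ^ 2) ∧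
    ∀ T > (0 : ℝ), ∃ M : ℝ, ∀ t ∈ Set.Icc (0 : ℝ) T, ∀ x,
      ‖hessian (fun z => Real.log (vpMarginal n pH t z)) x‖ ≤ M := by
  have key : ∀ t ≥ (0 : ℝ),
      (∀ x, 0 < vpMarginal n pH t x) ∧
      TwiceDiff (fun x => Real.log (vpMarginal n pH t x)) ∧
      ∀ x, ‖hessian (fun z => Real.log (vpMarginal n pH t z)) x‖ ≤
        1 / lam + R ^ 2 / lam ^ 2 := by
    intro t ht
    haveI : Nonempty (Fin n) := ⟨⟨0, hn⟩⟩
    have hlpos : 0 < lam := by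
      obtain ⟨i, hi⟩ := exists_eq_ciInf_of_finite (f := hS.1.eigenvalues)
      rw [hlam, ← hi]
      exact lt_min one_pos (hS.eigenvalues_pos i)
    have hl1 : lam ≤ 1 := hlam ▸ min_le_left _ _
    have hli : ∀ i, lam ≤ hS.1.eigenvalues i := fun i =>
      (hlam ▸ min_le_right _ _ : lam ≤ ⨅ i, hS.1.eigenvalues i).trans
        (ciInf_le (Set.finite_range _).bddBelow i)
    have hR : ∀ᵐ y ∂μ, ‖y‖ ≤ R := by
      rw [ae_iff]
      convert hsupp using 2
      ext y; simp
    set Sg := Matrix.toEuclideanCLM (𝕜 := ℝ) S with hSg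
    set B := Matrix.toEuclideanCLM (𝕜 := ℝ) S⁻¹ with hB
    have hdet : IsUnit S.det := hS.det_pos.ne'.isUnit
    have hSB : ∀ u, Sg (B u) = u := fun u => by
      rw [hSg, hB, ← ContinuousLinearMap.mul_apply, ← map_mul, Matrix.mul_nonsing_inv _ hdet,
        map_one, ContinuousLinearMap.one_apply]
    have hBS : ∀ u, B (Sg u) = u := fun u => by
      rw [hSg, hB, ← ContinuousLinearMap.mul_apply, ← map_mul, Matrix.nonsing_inv_mul _ hdet,
        map_one, ContinuousLinearMap.one_apply]
    have hSs : ∀ u v, ⟪Sg u, v⟫ = ⟪u, Sg v⟫ := aux_mat_symm hS.1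
    have hSl : ∀ v, lam * ‖v‖ ^ 2 ≤ ⟪Sg v, v⟫ := aux_mat_lower hS.1 hli
    obtain ⟨hB1, hB2, hB3⟩ := aux_inv_props Sg B hlpos hSs hSl hSB
    set c := ((2 * π) ^ n * S.det) ^ (-(1 : ℝ) / 2) with hc
    have hcpos : 0 < c := Real.rpow_pos_of_pos (mul_pos (by positivity) hS.det_pos) _
    have hfin : ∀ {A : EuclideanSpace ℝ (Fin n) →L[ℝ] EuclideanSpace ℝ (Fin n)} {a C : ℝ},
        0 ≤ a → a ≤ 1 → 0 < C → (∀ u v, ⟪A u, v⟫ = ⟪u, A v⟫) → (∀ u, 0 ≤ ⟪u, A u⟫) →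
        (∀ u, ‖A u‖ ≤ 1 / lam * ‖u‖) →
        (∀ x, vpMarginal n pH t x =
          C * ∫ y, Real.exp (-⟪x - a • y, A (x - a • y)⟫ / 2) ∂μ) →
      (∀ x, 0 < vpMarginal n pH t x) ∧
      TwiceDiff (fun x => Real.log (vpMarginal n pH t x)) ∧
      ∀ x, ‖hessian (fun z => Real.log (vpMarginal n pH t z)) x‖ ≤
        1 / lam + R ^ 2 / lam ^ 2 := by
      intro A a C h1 h2 h3 h4 h5 h6 h7
      have := aux_mixture μ A (by positivity) h1 h2 h3 h4 h5 h6 hR (vpMarginal n pH t) h7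
      refine ⟨this.1, this.2.1, fun x => (this.2.2 x).trans (le_of_eq ?_)⟩
      field_simp
    rcases ht.eq_or_lt with h0 | h0
    · refine hfin (A := B) (a := 1) (C := c) zero_le_one le_rfl hcpos hB1 hB2 hB3 fun x => ?_
      rw [vpMarginal, if_pos h0.symm, hpH, ← integral_const_mul]
      congr 1; ext y
      rw [aux_gaussMat, one_smul]
    · set a := Real.exp (-t / 2) with ha
      set s := 1 - Real.exp (-t) with hs
      have hapos : 0 < a := Real.exp_pos _
      have ha1 : a ≤ 1 := Real.exp_le_one_iff.2 (by linarith)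
      have hspos : 0 < s := by
        have : Real.exp (-t) < 1 := Real.exp_lt_one_iff.2 (by linarith)
        linarith
      have has : a ^ 2 = 1 - s := by
        rw [ha, hs, sq, ← Real.exp_add]; ring_nf
      set P : EuclideanSpace ℝ (Fin n) →L[ℝ] EuclideanSpace ℝ (Fin n) :=
        s • ContinuousLinearMap.id ℝ _ + a ^ 2 • Sg with hP
      have hPe : ∀ u, P u = s • u + a ^ 2 • Sg u := fun u => by simp [hP]
      have hPs : ∀ u v, ⟪P u, v⟫ = ⟪u, P v⟫ := fun u v => by
        simp only [hPe, inner_add_left, inner_add_right, inner_smul_left, inner_smul_right, hSs,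
          RCLike.conj_to_real]
      have hPl : ∀ v, lam * ‖v‖ ^ 2 ≤ ⟪P v, v⟫ := fun v => by
        rw [hPe, inner_add_left, inner_smul_left, inner_smul_left, real_inner_self_eq_norm_sq]
        simp only [RCLike.conj_to_real]
        have h1 := mul_le_mul_of_nonneg_left (hSl v) (sq_nonneg a)
        have h2 := mul_le_mul_of_nonneg_left hl1 (mul_nonneg hspos.le (sq_nonneg ‖v‖))
        have h3 : lam * ‖v‖ ^ 2 = a ^ 2 * (lam * ‖v‖ ^ 2) + s * ‖v‖ ^ 2 * lam := by
          rw [has]; ring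
        linarith
      obtain ⟨A, hA⟩ := aux_inverse P hlpos hPl
      obtain ⟨hA1, hA2, hA3⟩ := aux_inv_props P A hlpos hPs hPl hA
      obtain ⟨K, hK, hconv⟩ := aux_conv Sg B A hapos hspos hB1 hB2 hBS
        (fun u => by rw [← hPe]; exact hA u)
      set d := (2 * π * s) ^ (-(n : ℝ) / 2) with hd
      have hdpos : 0 < d := Real.rpow_pos_of_pos (by positivity) _
      refine hfin (A := A) (a := a) (C := c * d * K) hapos.le ha1 (by positivity) hA1 hA2 hA3
        fun x => ?_
      have hint : Integrable (Function.uncurry fun z y : EuclideanSpace ℝ (Fin n) =>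
          Real.exp (-⟪z - y, B (z - y)⟫ / 2) * Real.exp (-‖x - a • z‖ ^ 2 / (2 * s)))
          (volume.prod μ) := by
        have hg : Integrable (fun z : EuclideanSpace ℝ (Fin n) =>
            Real.exp (-‖x - a • z‖ ^ 2 / (2 * s))) := by
          have h1 := aux_gauss_integrable (V := EuclideanSpace ℝ (Fin n))
            (b := 1 / (2 * s)) (by positivity)
          have h2 := (h1.comp_sub_left x).comp_smul hapos.ne'
          refine h2.congr (Eventually.of_forall fun z => ?_)
          simp only
          congr 1; ring
        refine (hg.comp_fst μ).mono' (Continuous.aestronglyMeasurable (by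
          unfold Function.uncurry; fun_prop)) (Eventually.of_forall fun q => ?_)
        simp only [Function.uncurry]
        rw [Real.norm_of_nonneg (by positivity)]
        refine mul_le_of_le_one_left (Real.exp_pos _).le (Real.exp_le_one_iff.2 ?_)
        have := hB2 (q.1 - q.2)
        linarith
      rw [vpMarginal, if_neg h0.ne']
      have e1 : ∀ z, pH z * gaussKernel n (1 - Real.exp (-t)) (x - Real.exp (-t / 2) • z) =
          c * d * ∫ y, Real.exp (-⟪z - y, B (z - y)⟫ / 2) *
            Real.exp (-‖x - a • z‖ ^ 2 / (2 * s)) ∂μ := by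
        intro z
        rw [hpH, integral_mul_const, gaussKernel]
        simp only [aux_gaussMat, integral_const_mul]
        ring
      simp only [e1]
      rw [integral_const_mul, integral_integral_swap hint]
      simp only [hconv]
      rw [integral_const_mul]
      ring
  refine ⟨key, fun T _ => ⟨1 / lam + R ^ 2 / lam ^ 2, fun t ht x => (key t ht.1).2.2 x⟩⟩
end

section
/- Let p_H(x) = Σ_{k=1}^K α_k φ_Σ(x − m_k) be a finite Gaussian mixture on ℝ^n, with weights α_k > 0 summing to 1, means m_k ∈ ℝ^n, and a common symmetric positive definite covariance Σ. Set λ_* = min(1, λ_min(Σ)) and R = max_{1≤k≤K} ‖m_k‖. Then for every t ≥ 0 the VP marginal p_t is strictly positive, log p_t is twice differentiable, and for all x ∈ ℝ^n the operator norm of the Hessian satisfies ‖∇² log p_t(x)‖ ≤ 1/λ_* + R²/λ_*². In particular, sup_{t∈[0,T]} sup_{x∈ℝ^n} ‖∇² log p_t(x)‖ < ∞ for every T > 0. -/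
open MeasureTheory Real Filter Set
open scoped ENNReal Topology RealInnerProductSpace Classical

lemma aux_cov {K : ℕ} (w a b : Fin K → ℝ) (hw : ∀ k, 0 ≤ w k) (hs : ∑ k, w k = 1) (A B : ℝ)
    (hA : 0 ≤ A) (hB : 0 ≤ B)
    (ha : ∀ k, |a k| ≤ A) (hb : ∀ k, |b k| ≤ B) :
    |∑ k, w k * a k * b k - (∑ k, w k * a k) * (∑ k, w k * b k)| ≤ A * B := by
  set x := ∑ k, w k * a k with hx
  set y := ∑ k, w k * b k with hy
  have var : ∀ (c : Fin K → ℝ) (C : ℝ), (∀ k, |c k| ≤ C) →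
      ∑ k, w k * (c k - ∑ j, w j * c j) ^ 2 ≤ C ^ 2 := by
    intro c C hc
    set z := ∑ j, w j * c j with hz
    have e : ∑ k, w k * (c k - z) ^ 2 = ∑ k, w k * c k ^ 2 - z ^ 2 := by
      have : ∀ k, w k * (c k - z) ^ 2 = w k * c k ^ 2 - 2 * z * (w k * c k) + z ^ 2 * w k := by
        intro k; ring
      simp_rw [this]
      rw [Finset.sum_add_distrib, Finset.sum_sub_distrib, ← Finset.mul_sum, ← Finset.mul_sum, hs,
        ← hz]
      ring
    have h2 : ∑ k, w k * c k ^ 2 ≤ ∑ k, w k * C ^ 2 := by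
      refine Finset.sum_le_sum fun k _ => mul_le_mul_of_nonneg_left ?_ (hw k)
      have := abs_le.1 (hc k)
      exact sq_le_sq' this.1 this.2
    rw [← Finset.sum_mul, hs] at h2
    nlinarith [sq_nonneg z]
  have e : ∑ k, w k * a k * b k - x * y = ∑ k, (√(w k) * (a k - x)) * (√(w k) * (b k - y)) := by
    have : ∀ k, (√(w k) * (a k - x)) * (√(w k) * (b k - y)) =
        w k * a k * b k - y * (w k * a k) - x * (w k * b k) + x * y * w k := by
      intro k
      have := Real.mul_self_sqrt (hw k)
      linear_combination ((a k - x) * (b k - y)) * this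
    simp_rw [this]
    rw [Finset.sum_add_distrib, Finset.sum_sub_distrib, Finset.sum_sub_distrib, ← Finset.mul_sum,
      ← Finset.mul_sum, ← Finset.mul_sum, hs, ← hx, ← hy]
    ring
  rw [e]
  refine abs_le_of_sq_le_sq ?_ (by positivity)
  refine (Finset.sum_mul_sq_le_sq_mul_sq _ _ _).trans ?_
  rw [mul_pow]
  have ss : ∀ (c : Fin K → ℝ) (z : ℝ), ∑ k, (√(w k) * (c k - z)) ^ 2 = ∑ k, w k * (c k - z) ^ 2 := by
    intro c z
    refine Finset.sum_congr rfl fun k _ => ?_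
    rw [mul_pow, Real.sq_sqrt (hw k)]
  rw [ss, ss]
  refine mul_le_mul (var a A ha) (var b B hb) ?_ (by positivity)
  exact Finset.sum_nonneg fun k _ => mul_nonneg (hw k) (sq_nonneg _)

lemma aux_core {E : Type*} [NormedAddCommGroup E] [NormedSpace ℝ E] {K : ℕ} (hK : 0 < K)
    (Q : E →L[ℝ] E →L[ℝ] ℝ) (hQ : ∀ x y, Q x y = Q y x) (B : ℝ) (hQB : ‖Q‖ ≤ B)
    (c : Fin K → ℝ) (hc : ∀ k, 0 < c k) (L : Fin K → E →L[ℝ] ℝ) (ρ : ℝ) (hL : ∀ k, ‖L k‖ ≤ ρ)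
    (f : E → ℝ)
    (hf : ∀ x, f x = -(1/2) * Q x x + Real.log (∑ k, c k * Real.exp (L k x))) :
    TwiceDiff f ∧ ∀ x, ‖hessian f x‖ ≤ B + ρ ^ 2 := by
  have : Nonempty (Fin K) := ⟨⟨0, hK⟩⟩
  have hρ : 0 ≤ ρ := (norm_nonneg _).trans (hL ⟨0, hK⟩)
  set Z : E → ℝ := fun x => ∑ k, c k * Real.exp (L k x) with hZ
  set N : E → E →L[ℝ] ℝ := fun x => ∑ k, (c k * Real.exp (L k x)) • L k with hN
  have Zpos : ∀ x, 0 < Z x := fun x =>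
    Finset.sum_pos (fun k _ => mul_pos (hc k) (Real.exp_pos _)) Finset.univ_nonempty
  have hterm : ∀ k x, HasFDerivAt (fun x => c k * Real.exp (L k x))
      ((c k * Real.exp (L k x)) • L k) x := by
    intro k x
    have := ((L k).hasFDerivAt (x := x)).exp.const_mul (c k)
    rwa [smul_smul] at this
  have hZd : ∀ x, HasFDerivAt Z (N x) x := fun x =>
    HasFDerivAt.fun_sum fun k _ => hterm k x
  set N' : E → E →L[ℝ] E →L[ℝ] ℝ :=
    fun x => ∑ k, ((c k * Real.exp (L k x)) • L k).smulRight (L k) with hN'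
  have hNd : ∀ x, HasFDerivAt N (N' x) x := fun x =>
    HasFDerivAt.fun_sum fun k _ => (hterm k x).smul_const (L k)
  have hinv : ∀ x, HasFDerivAt (fun x => (Z x)⁻¹) ((-(Z x ^ 2)⁻¹) • N x) x := fun x =>
    (hasDerivAt_inv (Zpos x).ne').comp_hasFDerivAt x (hZd x)
  have hQd : ∀ x, HasFDerivAt (fun x => -(1/2) * Q x x) (-(Q x)) x := by
    intro x
    have h := ((Q.hasFDerivAt (x := x)).clm_apply (hasFDerivAt_id x)).const_mul (-(1/2 : ℝ))
    refine h.congr_fderiv ?_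
    ext v
    simp [hQ v x]
    ring
  have hfd : ∀ x, HasFDerivAt f (-(Q x) + (Z x)⁻¹ • N x) x := by
    intro x
    have : f = fun x => -(1/2) * Q x x + Real.log (Z x) := funext hf
    rw [this]
    exact (hQd x).add ((hZd x).log (Zpos x).ne')
  have hfe : fderiv ℝ f = fun x => -(Q x) + (Z x)⁻¹ • N x := funext fun x => (hfd x).fderiv
  have hfdd : ∀ x, HasFDerivAt (fderiv ℝ f)
      (-Q + ((Z x)⁻¹ • N' x + ((-(Z x ^ 2)⁻¹) • N x).smulRight (N x))) x := by
    intro x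
    rw [hfe]
    exact (Q.hasFDerivAt.neg).add ((hinv x).smul (hNd x))
  refine ⟨⟨fun x => (hfd x).differentiableAt, fun x => (hfdd x).differentiableAt⟩, fun x => ?_⟩
  rw [hessian, (hfdd x).fderiv]
  refine (norm_add_le _ _).trans (add_le_add ((norm_neg Q).trans_le hQB) ?_)
  refine ContinuousLinearMap.opNorm_le_bound₂ _ (by positivity) fun v w => ?_
  have hval : ((Z x)⁻¹ • N' x + ((-(Z x ^ 2)⁻¹) • N x).smulRight (N x)) v w =
      ∑ k, ((Z x)⁻¹ * (c k * Real.exp (L k x))) * L k v * L k w -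
      (∑ k, ((Z x)⁻¹ * (c k * Real.exp (L k x))) * L k v) *
      (∑ k, ((Z x)⁻¹ * (c k * Real.exp (L k x))) * L k w) := by
    simp only [mul_assoc (Z x)⁻¹, ← Finset.mul_sum]
    simp [hN, hN']
    ring
  rw [hval, Real.norm_eq_abs]
  refine (aux_cov _ _ _ (fun k => ?_) ?_ (ρ * ‖v‖) (ρ * ‖w‖) (by positivity) (by positivity)
    (fun k => ?_) (fun k => ?_)).trans (le_of_eq (by ring))
  · have := Zpos x; have := hc k; positivity
  · rw [← Finset.mul_sum]; exact inv_mul_cancel₀ (Zpos x).ne'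
  · exact ((L k).le_opNorm v).trans (by gcongr; exact hL k)
  · exact ((L k).le_opNorm w).trans (by gcongr; exact hL k)

/-- mixture form -/
lemma aux_mix {E : Type*} [NormedAddCommGroup E] [InnerProductSpace ℝ E] {K : ℕ} (hK : 0 < K)
    (T : E →L[ℝ] E) (hT : ∀ x y, ⟪T x, y⟫ = ⟪x, T y⟫) (B : ℝ) (hTB : ‖T‖ ≤ B)
    (c : Fin K → ℝ) (hc : ∀ k, 0 < c k) (μ : Fin K → E) (R : ℝ) (hμ : ∀ k, ‖μ k‖ ≤ R)
    (p : E → ℝ)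
    (hp : ∀ x, p x = ∑ k, c k * Real.exp (-⟪x - μ k, T (x - μ k)⟫ / 2)) :
    (∀ x, 0 < p x) ∧ TwiceDiff (fun x => Real.log (p x)) ∧
      ∀ x, ‖hessian (fun z => Real.log (p z)) x‖ ≤ B + (B * R) ^ 2 := by
  have hne : Nonempty (Fin K) := ⟨⟨0, hK⟩⟩
  have hB : 0 ≤ B := (norm_nonneg _).trans hTB
  have hpos : ∀ x, 0 < p x := fun x => by
    rw [hp]
    exact Finset.sum_pos (fun k _ => mul_pos (hc k) (Real.exp_pos _)) Finset.univ_nonempty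
  refine ⟨hpos, ?_⟩
  let Q0 : E →ₗ[ℝ] E →ₗ[ℝ] ℝ := LinearMap.mk₂ ℝ (fun x y => ⟪T x, y⟫)
    (fun x y z => by simp [inner_add_left]) (fun r x y => by simp [real_inner_smul_left])
    (fun x y z => by simp [inner_add_right]) (fun r x y => by simp [real_inner_smul_right])
  have hQ0 : ∀ x y, ‖Q0 x y‖ ≤ B * ‖x‖ * ‖y‖ := fun x y => by
    refine (norm_inner_le_norm (𝕜 := ℝ) (T x) y).trans ?_
    gcongr
    exact (T.le_opNorm x).trans (by gcongr)
  have hQv : ∀ x y, Q0.mkContinuous₂ B hQ0 x y = ⟪T x, y⟫ := fun x y => rfl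
  refine aux_core hK (Q0.mkContinuous₂ B hQ0) (fun x y => ?_) B
    (LinearMap.mkContinuous₂_norm_le _ hB _)
    (fun k => c k * Real.exp (-⟪μ k, T (μ k)⟫ / 2)) (fun k => mul_pos (hc k) (Real.exp_pos _))
    (fun k => Q0.mkContinuous₂ B hQ0 (μ k)) (B * R) (fun k => ?_) _ (fun x => ?_)
  · rw [hQv, hQv, hT, real_inner_comm]
  · refine ((Q0.mkContinuous₂ B hQ0).le_opNorm (μ k)).trans ?_
    gcongr
    · exact LinearMap.mkContinuous₂_norm_le _ hB _
    · exact hμ k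
  · have : p x = Real.exp (-(1/2) * ⟪T x, x⟫) *
        ∑ k, c k * Real.exp (-⟪μ k, T (μ k)⟫ / 2) * Real.exp ⟪T (μ k), x⟫ := by
      rw [hp, Finset.mul_sum]
      refine Finset.sum_congr rfl fun k _ => ?_
      have : -⟪x - μ k, T (x - μ k)⟫ / 2 =
          -(1/2) * ⟪T x, x⟫ + -⟪μ k, T (μ k)⟫ / 2 + ⟪T (μ k), x⟫ := by
        have h1 : ⟪x, T (μ k)⟫ = ⟪T (μ k), x⟫ := real_inner_comm _ _
        have h2 : ⟪μ k, T x⟫ = ⟪T (μ k), x⟫ := (hT _ _).symm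
        have h3 : ⟪x, T x⟫ = ⟪T x, x⟫ := (hT _ _).symm
        rw [map_sub, inner_sub_left, inner_sub_right, inner_sub_right, h1, h2, h3]
        ring
      rw [this, Real.exp_add, Real.exp_add]
      ring
    simp only [hQv]
    rw [this, Real.log_mul (Real.exp_pos _).ne', Real.log_exp]
    exact (Finset.sum_pos (fun k _ => mul_pos (mul_pos (hc k) (Real.exp_pos _)) (Real.exp_pos _))
      Finset.univ_nonempty).ne'

lemma aux_inv {E : Type*} [NormedAddCommGroup E] [InnerProductSpace ℝ E] [FiniteDimensional ℝ E]
    (M : E →L[ℝ] E) (hM : ∀ x y, ⟪M x, y⟫ = ⟪x, M y⟫) (lam : ℝ) (hl : 0 < lam)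
    (hc : ∀ x, lam * ‖x‖ ^ 2 ≤ ⟪x, M x⟫) :
    ∃ T : E →L[ℝ] E, (∀ x, M (T x) = x) ∧ (∀ x y, ⟪T x, y⟫ = ⟪x, T y⟫) ∧ ‖T‖ ≤ 1 / lam := by
  have hlow : ∀ x, lam * ‖x‖ ≤ ‖M x‖ := by
    intro x
    rcases (norm_nonneg x).eq_or_lt with h | h
    · rw [← h]; simp
    · have := (hc x).trans (real_inner_le_norm x (M x))
      nlinarith
  have hinj : Function.Injective (M : E →ₗ[ℝ] E) := by
    rw [← LinearMap.ker_eq_bot, LinearMap.ker_eq_bot']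
    intro x hx
    have := hlow x
    have hx' : M x = 0 := hx
    rw [hx', norm_zero] at this
    have : ‖x‖ ≤ 0 := by nlinarith [norm_nonneg x]
    simpa using this
  let e := LinearEquiv.ofInjectiveEndo (M : E →ₗ[ℝ] E) hinj
  let T : E →L[ℝ] E := LinearMap.toContinuousLinearMap (e.symm : E →ₗ[ℝ] E)
  have hMT : ∀ x, M (T x) = x := fun x => e.apply_symm_apply x
  refine ⟨T, hMT, fun x y => ?_, ?_⟩
  · calc ⟪T x, y⟫ = ⟪T x, M (T y)⟫ := by rw [hMT]
      _ = ⟪M (T x), T y⟫ := (hM _ _).symm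
      _ = ⟪x, T y⟫ := by rw [hMT]
  · refine T.opNorm_le_bound (by positivity) fun x => ?_
    have := hlow (T x)
    rw [hMT] at this
    rw [one_div, inv_mul_eq_div, le_div_iff₀ hl]
    linarith

lemma aux_eig {n : ℕ} (S : Matrix (Fin n) (Fin n) ℝ) (hS : S.IsHermitian) :
    ∀ x y, ⟪Matrix.toEuclideanCLM (𝕜 := ℝ) S x, y⟫ = ⟪x, Matrix.toEuclideanCLM (𝕜 := ℝ) S y⟫ := by
  intro x y
  have := (Matrix.isSymmetric_toEuclideanLin_iff.mpr hS) x y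
  exact this

lemma aux_low {n : ℕ} (S : Matrix (Fin n) (Fin n) ℝ) (hS : S.IsHermitian) (l : ℝ)
    (hl : ∀ i, l ≤ hS.eigenvalues i) (x : EuclideanSpace ℝ (Fin n)) :
    l * ‖x‖ ^ 2 ≤ ⟪x, Matrix.toEuclideanCLM (𝕜 := ℝ) S x⟫ := by
  set b := hS.eigenvectorBasis
  have hb : ∀ i, Matrix.toEuclideanCLM (𝕜 := ℝ) S (b i) = hS.eigenvalues i • b i := by
    intro i
    ext j
    exact congrFun (hS.mulVec_eigenvectorBasis i) j
  rw [← b.sum_inner_mul_inner, ← real_inner_self_eq_norm_sq, ← b.sum_inner_mul_inner, Finset.mul_sum]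
  refine Finset.sum_le_sum fun i _ => ?_
  rw [← aux_eig S hS, hb, real_inner_smul_left, real_inner_comm x (b i)]
  nlinarith [hl i, mul_self_nonneg ⟪x, b i⟫]

/-- Gaussian convolution without the constant. -/
lemma aux_conv_s7 {n : ℕ} (A Ai T : EuclideanSpace ℝ (Fin n) →L[ℝ] EuclideanSpace ℝ (Fin n))
    (hAi : ∀ x, Ai (A x) = x)
    (hAis : ∀ x y, ⟪Ai x, y⟫ = ⟪x, Ai y⟫) (hAip : ∀ x, 0 ≤ ⟪x, Ai x⟫)
    (a s : ℝ) (ha : 0 < a) (hs : 0 < s)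
    (hT : ∀ x, a ^ 2 • A (T x) + s • T x = x) :
    ∃ C : ℝ, 0 < C ∧ ∀ m x : EuclideanSpace ℝ (Fin n),
      Integrable (fun y => Real.exp (-⟪y - m, Ai (y - m)⟫ / 2) *
        Real.exp (-‖x - a • y‖ ^ 2 / (2 * s))) ∧
      ∫ y, Real.exp (-⟪y - m, Ai (y - m)⟫ / 2) * Real.exp (-‖x - a • y‖ ^ 2 / (2 * s)) =
        C * Real.exp (-⟪x - a • m, T (x - a • m)⟫ / 2) := by
  set g : EuclideanSpace ℝ (Fin n) → ℝ :=
    fun u => Real.exp (-(⟪u, Ai u⟫ + a ^ 2 * ‖u‖ ^ 2 / s) / 2) with hg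
  have hgi : Integrable g := by
    have hb : 0 < a ^ 2 / s / 2 := by positivity
    have h0 : Integrable (fun u : EuclideanSpace ℝ (Fin n) =>
        Real.exp (-(a ^ 2 / s / 2) * ‖u‖ ^ 2)) := by
      by_contra h
      have h1 := GaussianFourier.integral_rexp_neg_mul_sq_norm
        (V := EuclideanSpace ℝ (Fin n)) hb
      rw [integral_undef h] at h1
      have : 0 < (π / (a ^ 2 / s / 2)) ^ (Module.finrank ℝ (EuclideanSpace ℝ (Fin n)) / 2 : ℝ) := by
        positivity
      linarith
    refine h0.mono' (Continuous.aestronglyMeasurable (by fun_prop)) (Eventually.of_forall fun u => ?_)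
    rw [Real.norm_eq_abs, abs_of_pos (Real.exp_pos _)]
    apply Real.exp_le_exp.2
    have := hAip u
    have e : -(⟪u, Ai u⟫ + a ^ 2 * ‖u‖ ^ 2 / s) / 2 =
      -(a ^ 2 / s / 2) * ‖u‖ ^ 2 - ⟪u, Ai u⟫ / 2 := by ring
    linarith
  refine ⟨∫ u, g u, integral_exp_pos hgi, fun m x => ?_⟩
  set v := T (x - a • m) with hv
  have key : ∀ y, Real.exp (-⟪y - m, Ai (y - m)⟫ / 2) * Real.exp (-‖x - a • y‖ ^ 2 / (2 * s)) =
      g (y - (m + a • A v)) * Real.exp (-⟪x - a • m, v⟫ / 2) := by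
    intro y
    obtain ⟨u, hu⟩ : ∃ u, u = y - (m + a • A v) := ⟨_, rfl⟩
    have hy : y - m = u + a • A v := by rw [hu]; abel
    have hx : x - a • m = a ^ 2 • A v + s • v := (hT _).symm
    have hxy : x - a • y = s • v - a • u := by
      have : x - a • y = (x - a • m) - a • (y - m) := by rw [smul_sub]; abel
      rw [this, hx, hy, smul_add, smul_smul, pow_two]; abel
    rw [← hu, hg]
    simp only
    rw [← Real.exp_add, ← Real.exp_add, hy, hxy, hx]
    congr 1
    rw [map_add, map_smul, hAi, ← real_inner_self_eq_norm_sq, ← real_inner_self_eq_norm_sq]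
    simp only [inner_add_left, inner_add_right, inner_sub_left, inner_sub_right,
      real_inner_smul_left, real_inner_smul_right]
    have h1 : ⟪A v, Ai u⟫ = ⟪u, v⟫ := by rw [← hAis, hAi, real_inner_comm]
    rw [h1, real_inner_comm v u]
    field_simp
    ring
  simp_rw [key]
  constructor
  · exact (hgi.comp_sub_right _).mul_const _
  · rw [integral_mul_const, integral_sub_right_eq_self g]

lemma aux_main (n K : ℕ) (hn : 0 < n) (hK : 0 < K)
    (S : Matrix (Fin n) (Fin n) ℝ) (hS : S.PosDef)
    (α : Fin K → ℝ) (hα : ∀ k, 0 < α k)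
    (m : Fin K → EuclideanSpace ℝ (Fin n))
    (pH : EuclideanSpace ℝ (Fin n) → ℝ)
    (hpH : ∀ x, pH x = ∑ k, α k * gaussMat n S (x - m k))
    (lam R : ℝ) (hlam : lam = min 1 (⨅ i, hS.1.eigenvalues i))
    (hR : R = ⨆ k, ‖m k‖) (t : ℝ) (ht : 0 ≤ t) :
      (∀ x, 0 < vpMarginal n pH t x) ∧
      TwiceDiff (fun x => Real.log (vpMarginal n pH t x)) ∧
      ∀ x, ‖hessian (fun z => Real.log (vpMarginal n pH t z)) x‖ ≤
        1 / lam + R ^ 2 / lam ^ 2 := by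
  have : Nonempty (Fin n) := ⟨⟨0, hn⟩⟩
  have hmin : ∀ i, (⨅ i, hS.1.eigenvalues i) ≤ hS.1.eigenvalues i :=
    fun i => ciInf_le (Set.finite_range _).bddBelow i
  have hl0 : 0 < lam := by
    obtain ⟨i, hi⟩ := exists_eq_ciInf_of_finite (f := hS.1.eigenvalues)
    rw [hlam, ← hi]
    exact lt_min one_pos (hS.eigenvalues_pos i)
  have hl1 : lam ≤ 1 := hlam ▸ min_le_left _ _
  have hle : ∀ i, lam ≤ hS.1.eigenvalues i := fun i => hlam ▸ (min_le_right _ _).trans (hmin i)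
  have hmR : ∀ k, ‖m k‖ ≤ R := fun k => hR ▸ le_ciSup (f := fun k => ‖m k‖) (Set.finite_range _).bddAbove k
  set A := Matrix.toEuclideanCLM (𝕜 := ℝ) S with hAdef
  set Ai := Matrix.toEuclideanCLM (𝕜 := ℝ) S⁻¹ with hAidef
  have hdet : IsUnit S.det := hS.det_pos.ne'.isUnit
  have hAs := aux_eig S hS.1
  have hAis := aux_eig S⁻¹ hS.inv.1
  have hAiA : ∀ x, Ai (A x) = x := fun x => by
    have : Ai * A = 1 := by rw [hAidef, hAdef, ← map_mul, Matrix.nonsing_inv_mul _ hdet, map_one]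
    exact congrArg (fun F => F x) this
  have hAAi : ∀ x, A (Ai x) = x := fun x => by
    have : A * Ai = 1 := by rw [hAidef, hAdef, ← map_mul, Matrix.mul_nonsing_inv _ hdet, map_one]
    exact congrArg (fun F => F x) this
  have hAlow : ∀ x, lam * ‖x‖ ^ 2 ≤ ⟪x, A x⟫ := aux_low S hS.1 lam hle
  have hAip : ∀ x, 0 ≤ ⟪x, Ai x⟫ := fun x => by
    have := hAlow (Ai x)
    rw [hAAi, real_inner_comm] at this
    exact le_trans (by positivity) this
  set c0 : ℝ := ((2 * π) ^ n * S.det) ^ (-(1 : ℝ) / 2) with hc0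
  have hc0p : 0 < c0 := by
    have := hS.det_pos
    positivity
  have hgm : ∀ z, gaussMat n S z = c0 * Real.exp (-⟪z, Ai z⟫ / 2) := by
    intro z
    rw [hAidef, Matrix.inner_toEuclideanCLM]
    rfl
  set a := Real.exp (-t / 2) with ha
  set s := 1 - Real.exp (-t) with hs
  have ha0 : 0 < a := Real.exp_pos _
  have ha2 : a ^ 2 + s = 1 := by
    rw [ha, hs, ← Real.exp_nat_mul]
    have : ((2 : ℕ) : ℝ) * (-t / 2) = -t := by push_cast; ring
    rw [this]; ring
  have ha1 : a ≤ 1 := Real.exp_le_one_iff.2 (by linarith)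
  have hs0 : 0 ≤ s := by rw [hs]; linarith [Real.exp_le_one_iff.2 (by linarith : -t ≤ 0)]
  obtain ⟨T, hMT, hTs, hTn⟩ := aux_inv (a ^ 2 • A + s • ContinuousLinearMap.id ℝ _)
    (fun x y => by
      simp [inner_add_left, inner_add_right, real_inner_smul_left, real_inner_smul_right, A, hAs])
    lam hl0 (fun x => by
      simp only [add_apply, smul_apply,
        ContinuousLinearMap.id_apply, inner_add_right, real_inner_smul_right,
        real_inner_self_eq_norm_sq]
      have h1 := mul_le_mul_of_nonneg_left (hAlow x) (sq_nonneg a)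
      have h2 := mul_le_mul_of_nonneg_left hl1 (mul_nonneg hs0 (sq_nonneg ‖x‖))
      have h3 : lam * ‖x‖ ^ 2 = a ^ 2 * (lam * ‖x‖ ^ 2) + s * ‖x‖ ^ 2 * lam := by
        linear_combination (-(lam * ‖x‖ ^ 2)) * ha2
      linarith)
  have hMT' : ∀ x, a ^ 2 • A (T x) + s • T x = x := hMT
  obtain ⟨D, hD, hform⟩ : ∃ D : ℝ, 0 < D ∧ ∀ x, vpMarginal n pH t x =
      ∑ k, (D * α k) * Real.exp (-⟪x - a • m k, T (x - a • m k)⟫ / 2) := by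
    rcases eq_or_ne t 0 with h0 | h0
    · refine ⟨c0, hc0p, fun x => ?_⟩
      have ha' : a = 1 := by rw [ha, h0]; simp
      have hs' : s = 0 := by rw [hs, h0]; simp
      have hTA : ∀ x, T x = Ai x := fun x => by
        have := hMT' x
        rw [ha', hs'] at this
        simp only [one_pow, one_smul, zero_smul, add_zero] at this
        rw [← hAiA (T x), this]
      rw [vpMarginal, if_pos h0, hpH]
      refine Finset.sum_congr rfl fun k _ => ?_
      rw [hgm, ha', one_smul, hTA]; ring
    · have htp : 0 < t := lt_of_le_of_ne ht h0.symm
      have hsp : 0 < s := by rw [hs]; linarith [Real.exp_lt_one_iff.2 (by linarith : -t < 0)]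
      obtain ⟨C, hC, hCf⟩ := aux_conv_s7 A Ai T hAiA hAis hAip a s ha0 hsp hMT'
      set g0 : ℝ := (2 * π * s) ^ (-(n : ℝ) / 2) with hg0
      have hg0p : 0 < g0 := by positivity
      refine ⟨c0 * g0 * C, by positivity, fun x => ?_⟩
      rw [vpMarginal, if_neg h0]
      have e : ∀ y, pH y * gaussKernel n s (x - a • y) = ∑ k, (α k * c0 * g0) *
          (Real.exp (-⟪y - m k, Ai (y - m k)⟫ / 2) *
            Real.exp (-‖x - a • y‖ ^ 2 / (2 * s))) := by
        intro y
        rw [hpH, Finset.sum_mul, gaussKernel]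
        refine Finset.sum_congr rfl fun k _ => ?_
        rw [hgm]; ring
      change ∫ y, pH y * gaussKernel n s (x - a • y) = _
      simp_rw [e]
      rw [integral_finsetSum _ fun k _ => ((hCf (m k) x).1.const_mul _)]
      refine Finset.sum_congr rfl fun k _ => ?_
      rw [integral_const_mul, (hCf (m k) x).2]; ring
  have hfin := aux_mix hK T hTs (1 / lam) hTn (fun k => D * α k) (fun k => mul_pos hD (hα k))
    (fun k => a • m k) R (fun k => by
      rw [norm_smul, Real.norm_eq_abs, abs_of_pos ha0]
      exact (mul_le_of_le_one_left (norm_nonneg _) ha1).trans (hmR k)) (vpMarginal n pH t) hform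
  refine ⟨hfin.1, hfin.2.1, fun x => (hfin.2.2 x).trans (le_of_eq ?_)⟩
  rw [mul_pow, div_pow, one_pow]; ring


/-- Corollary (Gaussian mixtures): for a finite Gaussian mixture with common covariance `Σ`,
the VP score is uniformly Lipschitz on `[0,T] × ℝⁿ`, with explicit bound `1/λ⁎ + R²/λ⁎²`,
`λ⁎ = min(1, λ_min(Σ))`, `R = max_k ‖m_k‖`. -/
theorem stmt_7 (n K : ℕ) (hn : 0 < n) (hK : 0 < K)
    (S : Matrix (Fin n) (Fin n) ℝ) (hS : S.PosDef)
    (α : Fin K → ℝ) (hα : ∀ k, 0 < α k) (hαsum : ∑ k, α k = 1)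
    (m : Fin K → EuclideanSpace ℝ (Fin n))
    (pH : EuclideanSpace ℝ (Fin n) → ℝ)
    (hpH : ∀ x, pH x = ∑ k, α k * gaussMat n S (x - m k))
    (lam R : ℝ) (hlam : lam = min 1 (⨅ i, hS.1.eigenvalues i))
    (hR : R = ⨆ k, ‖m k‖) :
    (∀ t ≥ (0 : ℝ),
      (∀ x, 0 < vpMarginal n pH t x) ∧
      TwiceDiff (fun x => Real.log (vpMarginal n pH t x)) ∧
      ∀ x, ‖hessian (fun z => Real.log (vpMarginal n pH t z)) x‖ ≤
        1 / lam + R ^ 2 / lam ^ 2) ∧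
    ∀ T > (0 : ℝ), ∃ M : ℝ, ∀ t ∈ Set.Icc (0 : ℝ) T, ∀ x,
      ‖hessian (fun z => Real.log (vpMarginal n pH t z)) x‖ ≤ M := by
  have key := aux_main n K hn hK S hS α hα m pH hpH lam R hlam hR
  exact ⟨fun t ht => key t ht, fun T _ => ⟨_, fun t ht x => (key t ht.1).2.2 x⟩⟩
end

section
/- Let Σ ∈ ℝ^{n×n} be symmetric positive definite, μ a compactly supported probability measure on ℝ^n, and p_H(x) = ∫ φ_Σ(x − y) dμ(y). For t ≥ 0 set S_t = a(t)²Σ + σ²(t)I_n. Then for every t ≥ 0 and x ∈ ℝ^n: (a) the VP marginal satisfies p_t(x) = ∫ φ_{S_t}(x − a(t)y) dμ(y) > 0; and (b) log p_t is twice differentiable in x with ∇²_x log p_t(x) = −S_t^{-1} + a(t)² S_t^{-1} Cov(μ_{t,x}) S_t^{-1}, where μ_{t,x} is the probability measure dμ_{t,x}(y) = (φ_{S_t}(x − a(t)y)/p_t(x)) dμ(y) and Cov(μ_{t,x}) = ∫ y yᵀ dμ_{t,x}(y) − (∫ y dμ_{t,x}(y))(∫ y dμ_{t,x}(y))ᵀ.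 -/
open MeasureTheory Real Filter Set
open scoped ENNReal Topology RealInnerProductSpace Classical

noncomputable section

/-- Covariance matrix of a measure on `ℝⁿ`. -/
def covMatrix (n : ℕ) (ν : Measure (EuclideanSpace ℝ (Fin n))) :
    Matrix (Fin n) (Fin n) ℝ :=
  Matrix.of fun i j => (∫ y, y i * y j ∂ν) - (∫ y, y i ∂ν) * (∫ y, y j ∂ν)

/-- Posterior measure `μ_{t,x}` with density `φ_{S}(x - a y)/p` with respect to `μ`. -/
def postMeasure (n : ℕ) (μ : Measure (EuclideanSpace ℝ (Fin n)))
    (S : Matrix (Fin n) (Fin n) ℝ) (a p : ℝ) (x : EuclideanSpace ℝ (Fin n)) :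
    Measure (EuclideanSpace ℝ (Fin n)) :=
  μ.withDensity fun y => ENNReal.ofReal (gaussMat n S (x - a • y) / p)

end


theorem cont_add_aux {E F : Type*} [NormedAddCommGroup E] [NormedSpace ℝ E]
    [NormedAddCommGroup F] [NormedSpace ℝ F] (c : E →L[ℝ] F)
    (k : E → ℝ) (f : E → E →L[ℝ] ℝ) (h : E → F) (hk : Continuous k) (hf : Continuous f)
    (hh : Continuous h) : Continuous fun z => k z • c + (f z).smulRight (h z) := by
  refine Continuous.add (hk.smul continuous_const) ?_
  exact ((ContinuousLinearMap.smulRightL ℝ E F).continuous.comp hf).clm_apply hh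

theorem param_aux {E G : Type*} [NormedAddCommGroup E] [NormedSpace ℝ E] [FiniteDimensional ℝ E]
    [MeasurableSpace E] [BorelSpace E] 
    [NormedAddCommGroup G] [NormedSpace ℝ G] 
    (μ : Measure E) [IsFiniteMeasure μ] (K : Set E) (hK : IsCompact K) (hμ : μ Kᶜ = 0)
    (a : ℝ) (g : E → G) (g' : E → E →L[ℝ] G) (hg : ∀ z, HasFDerivAt g (g' z) z)
    (hg' : Continuous g') (x : E) :
    HasFDerivAt (fun x => ∫ y, g (x - a • y) ∂μ) (∫ y, g' (x - a • y) ∂μ) x := by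
  have hc : Continuous g := continuous_iff_continuousAt.2 fun z => (hg z).continuousAt
  have hae : ∀ᵐ y ∂μ, y ∈ K := by rw [ae_iff]; exact hμ
  have hprod : IsCompact ((fun q : E × E => q.1 - a • q.2) '' (Metric.closedBall x 1 ×ˢ K)) :=
    ((isCompact_closedBall x 1).prod hK).image (by fun_prop)
  obtain ⟨C, hC⟩ := hprod.exists_bound_of_continuousOn hg'.continuousOn
  obtain ⟨C', hC'⟩ := hprod.exists_bound_of_continuousOn hc.continuousOn
  have hfd := FiniteDimensional.proper_real E
  refine hasFDerivAt_integral_of_dominated_of_fderiv_le (s := Metric.closedBall x 1)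
    (bound := fun _ => C) (F := fun x y => g (x - a • y)) (F' := fun x y => g' (x - a • y))
    (Metric.closedBall_mem_nhds x one_pos) ?_ ?_ ?_ ?_ (integrable_const _) ?_
  · exact Eventually.of_forall fun z =>
      (show Continuous fun y => g (z - a • y) by fun_prop).aestronglyMeasurable
  · refine Integrable.of_bound 
      (show Continuous fun y => g (x - a • y) by fun_prop).aestronglyMeasurable C' ?_
    filter_upwards [hae] with y hy
    exact hC' _ ⟨(x, y), ⟨Metric.mem_closedBall_self zero_le_one, hy⟩, rfl⟩
  · exact (show Continuous fun y => g' (x - a • y) by fun_prop).aestronglyMeasurable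
  · filter_upwards [hae] with y hy z hz
    exact hC _ ⟨(z, y), ⟨hz, hy⟩, rfl⟩
  · refine Eventually.of_forall fun y z _ => ?_
    have h := (hg (z - a • y)).comp z ((hasFDerivAt_id z).sub_const (a • y))
    rw [ContinuousLinearMap.comp_id] at h
    exact h

theorem int_aux {E G : Type*} [NormedAddCommGroup E] [NormedSpace ℝ E] [FiniteDimensional ℝ E]
    [MeasurableSpace E] [BorelSpace E] 
    [NormedAddCommGroup G] [NormedSpace ℝ G] 
    (μ : Measure E) [IsFiniteMeasure μ] (K : Set E) (hK : IsCompact K) (hμ : μ Kᶜ = 0)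
    (g : E → G) (hc : Continuous g) : Integrable g μ := by
  have hae : ∀ᵐ y ∂μ, y ∈ K := by rw [ae_iff]; exact hμ
  obtain ⟨C', hC'⟩ := hK.exists_bound_of_continuousOn hc.continuousOn
  refine Integrable.of_bound hc.aestronglyMeasurable C' ?_
  filter_upwards [hae] with y hy
  exact hC' _ hy

theorem hess_aux {E : Type*} [NormedAddCommGroup E] [NormedSpace ℝ E] [FiniteDimensional ℝ E]
    [MeasurableSpace E] [BorelSpace E] 
    (μ : Measure E) [IsProbabilityMeasure μ] (K : Set E) (hK : IsCompact K) (hμ : μ Kᶜ = 0)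
    (a c : ℝ) (hc : 0 < c) (b : E →L[ℝ] E →L[ℝ] ℝ) (hb : ∀ u v, b u v = b v u)
    (g : E → ℝ) (hg : ∀ z, g z = c * Real.exp (-(b z z) / 2))
    (p : E → ℝ) (hp : ∀ x, p x = ∫ y, g (x - a • y) ∂μ) :
    (∀ x, 0 < p x) ∧ TwiceDiff (fun x => Real.log (p x)) ∧
    ∀ x u w, hessian (fun x => Real.log (p x)) x u w = - b u w + a ^ 2 *
      ((∫ y, b y u * b y w ∂(μ.withDensity fun y => ENNReal.ofReal (g (x - a • y) / p x))) -
      (∫ y, b y u ∂(μ.withDensity fun y => ENNReal.ofReal (g (x - a • y) / p x))) * 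
      (∫ y, b y w ∂(μ.withDensity fun y => ENNReal.ofReal (g (x - a • y) / p x)))) := by
  have hgc : Continuous g := by
    rw [show g = _ from funext hg]; fun_prop
  have gpos : ∀ z, 0 < g z := fun z => by rw [hg]; positivity
  have hint : ∀ f : E → ℝ, Continuous f → Integrable f μ := fun f hf => int_aux μ K hK hμ f hf
  have ppos : ∀ x, 0 < p x := fun x => by
    rw [hp, integral_pos_iff_support_of_nonneg (fun y => (gpos _).le) (hint _ (by fun_prop))]
    have : Function.support (fun y => g (x - a • y)) = univ := by
      ext y; simpa using (gpos _).ne'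
    rw [this]; simp
  -- derivatives of g
  have hg1 : ∀ z, HasFDerivAt g (-(g z) • b z) z := by
    intro z
    have h1 : HasFDerivAt (fun z => b z z) ((2:ℝ) • b z) z := by
      have := (b.hasFDerivAt (x := z)).clm_apply (hasFDerivAt_id z)
      refine this.congr_fderiv ?_
      ext w
      simp [hb w z]; ring
    have h2 := ((h1.neg.mul_const (2:ℝ)⁻¹).exp).const_mul c
    rw [show g = fun z => c * Real.exp (-(b z z) * 2⁻¹) from funext fun z => by rw [hg, div_eq_mul_inv]]
    refine h2.congr_fderiv ?_
    ext w
    simp; ring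
  set g2 : E → E →L[ℝ] E →L[ℝ] ℝ := fun z => 
    -(g z) • b + (-(-(g z) • b z)).smulRight (b z) with hg2def
  have hg2 : ∀ z, HasFDerivAt (fun z => -(g z) • b z) (g2 z) z := fun z =>
    ((hg1 z).neg).smul (b.hasFDerivAt (x := z))
  have hg1c : Continuous (fun z => -(g z) • b z) :=
    continuous_iff_continuousAt.2 fun z => (hg2 z).continuousAt
  have hg2c : Continuous g2 := by
    exact cont_add_aux b (fun z => -(g z)) (fun z => (-(-(g z) • b z))) b
      hgc.neg hg1c.neg b.continuous
  have hp1 : ∀ x, HasFDerivAt p (∫ y, (fun z => -(g z) • b z) (x - a • y) ∂μ) x := by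
    rw [show p = _ from funext hp]
    exact param_aux μ K hK hμ a g _ hg1 hg1c
  have hp2 := param_aux μ K hK hμ a _ g2 hg2 hg2c
  set p1 : E → E →L[ℝ] ℝ := fun x => ∫ y, (fun z => -(g z) • b z) (x - a • y) ∂μ with hp1def
  have hl1 : ∀ x, HasFDerivAt (fun x => Real.log (p x)) ((p x)⁻¹ • p1 x) x := fun x =>
    (hp1 x).log (ppos x).ne'
  have hfd : fderiv ℝ (fun x => Real.log (p x)) = fun x => (p x)⁻¹ • p1 x :=
    funext fun x => (hl1 x).fderiv
  have hinv : ∀ x, HasFDerivAt (fun x => (p x)⁻¹) (-((p x)^2)⁻¹ • p1 x) x := fun x => by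
    have := (hasDerivAt_inv (ppos x).ne').comp_hasFDerivAt x (hp1 x)
    exact this
  have hl2 := fun x => (hinv x).smul (hp2 x)
  refine ⟨ppos, ⟨fun x => (hl1 x).differentiableAt, ?_⟩, ?_⟩
  · rw [hfd]; exact fun x => (hl2 x).differentiableAt
  intro x u w
  have hw : ∀ f : E → ℝ, ∫ y, f y ∂(μ.withDensity fun y => ENNReal.ofReal (g (x - a • y) / p x))
      = (p x)⁻¹ * ∫ y, g (x - a • y) * f y ∂μ := by
    intro f
    rw [integral_withDensity_eq_integral_toReal_smul (by fun_prop) (by simp), 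
      ← integral_const_mul]
    refine integral_congr_ae (Eventually.of_forall fun y => ?_)
    simp only [smul_eq_mul]
    rw [ENNReal.toReal_ofReal (div_nonneg (gpos _).le (ppos _).le)]
    ring
  simp only [hw]
  have e1 : ∀ w, p1 x w = ∫ y, -(g (x - a • y)) * b (x - a • y) w ∂μ := by
    intro w
    rw [hp1def]
    simp only
    have hcc : Continuous fun y => -(g (x - a • y)) • b (x - a • y) := by fun_prop
    rw [ContinuousLinearMap.integral_apply (int_aux μ K hK hμ _ hcc)]
    simp
  have hg2c' : Continuous fun y => g2 (x - a • y) := by fun_prop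
  have e2 : (∫ y, g2 (x - a • y) ∂μ) u w = ∫ y, -(g (x - a • y)) * b u w + g (x - a • y) * b (x - a • y) u * b (x - a • y) w ∂μ := by
    rw [ContinuousLinearMap.integral_apply (int_aux μ K hK hμ _ hg2c'),
      ContinuousLinearMap.integral_apply (int_aux μ K hK hμ _ (by fun_prop))]
    simp [hg2def]
  have e3 : hessian (fun x => Real.log (p x)) x u w = (p x)⁻¹ * (∫ y, g2 (x - a • y) ∂μ) u w
      - ((p x)^2)⁻¹ * p1 x u * p1 x w := by
    unfold hessian
    rw [hfd]
    erw [(hl2 x).fderiv]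
    simp
    ring
  have f1 : ∀ w, p1 x w = -(b x w * p x) + a * ∫ y, g (x - a • y) * b y w ∂μ := by
    intro w
    rw [e1, hp, ← integral_const_mul, ← integral_const_mul, ← integral_neg, ← integral_add
      (hint _ (by fun_prop)) (hint _ (by fun_prop))]
    refine integral_congr_ae (Eventually.of_forall fun y => ?_)
    simp
    ring
  have f2 : (∫ y, g2 (x - a • y) ∂μ) u w = (b x u * b x w - b u w) * p x 
     + (-(a * b x u)) * (∫ y, g (x - a • y) * b y w ∂μ) + (-(a * b x w)) * (∫ y, g (x - a • y) * b y u ∂μ)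
     + a ^ 2 * ∫ y, g (x - a • y) * (b y u * b y w) ∂μ := by
    rw [e2, hp, ← integral_const_mul, ← integral_const_mul, ← integral_const_mul, ← integral_const_mul, ← integral_add
      (hint _ (by fun_prop)) (hint _ (by fun_prop)), ← integral_add
      (hint _ (by fun_prop)) (hint _ (by fun_prop)), ← integral_add
      (hint _ (by fun_prop)) (hint _ (by fun_prop))]
    refine integral_congr_ae (Eventually.of_forall fun y => ?_)
    simp
    ring
  rw [e3, f2, f1, f1]
  have := (ppos x).ne'
  field_simp
  ring

theorem gauss_int_aux (n : ℕ) (M : Matrix (Fin n) (Fin n) ℝ) (hM : M.PosDef) :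
    ∫ z : EuclideanSpace ℝ (Fin n), Real.exp (-(z.ofLp ⬝ᵥ M.mulVec z.ofLp) / 2) =
      (2 * π) ^ ((n : ℝ) / 2) * M.det ^ (-(1 : ℝ) / 2) := by
  open scoped MatrixOrder in
  obtain ⟨B, hB⟩ := CStarAlgebra.nonneg_iff_eq_star_mul_self.mp hM.posSemidef.nonneg
  have hB' : M = B.transpose * B := by rw [hB, Matrix.star_eq_conjTranspose]; rfl
  have hdet : M.det = B.det ^ 2 := by rw [hB', Matrix.det_mul, Matrix.det_transpose, sq]
  have hpos := hM.det_pos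
  have hBdet : B.det ≠ 0 := by rintro h; rw [hdet, h] at hpos; simp at hpos
  set L : EuclideanSpace ℝ (Fin n) →L[ℝ] EuclideanSpace ℝ (Fin n) :=
    LinearMap.toContinuousLinearMap (Matrix.toEuclideanLin B) with hL
  have hLdet : L.det = B.det := by
    rw [hL, LinearMap.det_toContinuousLinearMap]
    exact LinearMap.det_toLin (PiLp.basisFun 2 ℝ (Fin n)) B
  have hLap : ∀ z, (L z).ofLp = B.mulVec z.ofLp := fun z => rfl
  have hq : ∀ z : EuclideanSpace ℝ (Fin n), z.ofLp ⬝ᵥ M.mulVec z.ofLp = ‖L z‖ ^ 2 := by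
    intro z
    rw [EuclideanSpace.real_norm_sq_eq, hB', ← Matrix.mulVec_mulVec, Matrix.dotProduct_mulVec,
      Matrix.vecMul_transpose, hLap]
    simp [dotProduct, sq]
  have hinj : Function.Injective L := by
    have : IsUnit L.det := by rw [hLdet]; exact hBdet.isUnit
    exact (LinearMap.equivOfDetNeZero (L : _ →ₗ[ℝ] _) (by 
      rw [isUnit_iff_ne_zero] at this; exact this)).injective
  have hsurj : Function.Surjective L := 
    LinearMap.injective_iff_surjective (f := L.toLinearMap).1 hinj
  have key := integral_image_eq_integral_abs_det_fderiv_smul volume (s := univ) (f := L)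
    (f' := fun _ => L) MeasurableSet.univ (fun x _ => L.hasFDerivWithinAt) hinj.injOn
    (fun z => Real.exp (-(1/2 : ℝ) * ‖z‖ ^ 2))
  rw [image_univ, hsurj.range_eq, setIntegral_univ, setIntegral_univ,
    GaussianFourier.integral_rexp_neg_mul_sq_norm (by norm_num), integral_smul, hLdet] at key
  simp only [hq]
  have h1 : M.det ^ (-(1 : ℝ) / 2) = |B.det|⁻¹ := by
    rw [hdet, neg_div, Real.rpow_neg (sq_nonneg _), ← Real.sqrt_eq_rpow, Real.sqrt_sq_eq_abs]
  rw [h1, eq_mul_inv_iff_mul_eq₀ (abs_ne_zero.2 hBdet)]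
  have h2 : π / (1/2) = 2 * π := by ring
  rw [h2, finrank_euclideanSpace_fin, smul_eq_mul] at key
  rw [key, mul_comm]
  congr 2
  ext z
  congr 1
  ring

theorem sq_aux (n : ℕ) (S : Matrix (Fin n) (Fin n) ℝ) (hS : S.PosDef) (a s : ℝ) (hs : 0 < s)
    (m : Fin n → ℝ) : 
    (S⁻¹ + (a ^ 2 / s) • (1 : Matrix (Fin n) (Fin n) ℝ)).PosDef ∧
    (a ^ 2 • S + s • (1 : Matrix (Fin n) (Fin n) ℝ)).PosDef ∧
    (a ^ 2 • S + s • (1 : Matrix (Fin n) (Fin n) ℝ)).det = s ^ n * S.det * 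
      (S⁻¹ + (a ^ 2 / s) • (1 : Matrix (Fin n) (Fin n) ℝ)).det ∧
    ∃ z0 : Fin n → ℝ, ∀ z : Fin n → ℝ,
      z ⬝ᵥ S⁻¹.mulVec z + (m - a • z) ⬝ᵥ (m - a • z) / s =
       (z - z0) ⬝ᵥ (S⁻¹ + (a ^ 2 / s) • (1 : Matrix (Fin n) (Fin n) ℝ)).mulVec (z - z0) +
       m ⬝ᵥ (a ^ 2 • S + s • (1 : Matrix (Fin n) (Fin n) ℝ))⁻¹.mulVec m := by
  have hM : (S⁻¹ + (a ^ 2 / s) • (1 : Matrix (Fin n) (Fin n) ℝ)).PosDef :=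
    hS.inv.add_posSemidef (Matrix.PosSemidef.one.smul (by positivity))
  have hT : (a ^ 2 • S + s • (1 : Matrix (Fin n) (Fin n) ℝ)).PosDef :=
    Matrix.PosDef.posSemidef_add (hS.posSemidef.smul (by positivity)) (Matrix.PosDef.one.smul hs)
  have hSS : S * S⁻¹ = 1 := Matrix.mul_nonsing_inv _ hS.det_pos.ne'.isUnit
  have hprod : a ^ 2 • S + s • (1 : Matrix (Fin n) (Fin n) ℝ) = 
      (s • S) * (S⁻¹ + (a ^ 2 / s) • (1 : Matrix (Fin n) (Fin n) ℝ)) := by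
    rw [mul_add, Matrix.smul_mul, hSS, Matrix.mul_smul, mul_one, smul_smul,
      div_mul_cancel₀ _ hs.ne', add_comm]
  refine ⟨hM, hT, ?_, ?_⟩
  · rw [hprod, Matrix.det_mul, Matrix.det_smul]; simp
  set M := S⁻¹ + (a ^ 2 / s) • (1 : Matrix (Fin n) (Fin n) ℝ) with hMdef
  set T := a ^ 2 • S + s • (1 : Matrix (Fin n) (Fin n) ℝ) with hTdef
  set z0 := (a / s) • M⁻¹.mulVec m with hz0
  have hMz : M.mulVec z0 = (a / s) • m := by
    rw [hz0, Matrix.mulVec_smul, Matrix.mulVec_mulVec, Matrix.mul_nonsing_inv _ hM.det_pos.ne'.isUnit,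
      Matrix.one_mulVec]
  have hTm : T⁻¹.mulVec m = s⁻¹ • m - (a / s) • z0 := by
    have h1 : T.mulVec (s⁻¹ • m - (a / s) • z0) = m := by
      have h2 : T.mulVec z0 = a • S.mulVec m := by
        rw [hprod, ← Matrix.mulVec_mulVec, hMz, Matrix.mulVec_smul, Matrix.smul_mulVec, smul_smul,
          div_mul_cancel₀ _ hs.ne']
      rw [Matrix.mulVec_sub, Matrix.mulVec_smul, Matrix.mulVec_smul, h2, hTdef, Matrix.add_mulVec,
        Matrix.smul_mulVec, Matrix.smul_mulVec, Matrix.one_mulVec]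
      ext i
      simp
      field_simp
      ring
    conv_lhs => rw [← h1]
    rw [Matrix.mulVec_mulVec, Matrix.nonsing_inv_mul _ hT.det_pos.ne'.isUnit, Matrix.one_mulVec]
  refine ⟨z0, fun z => ?_⟩
  have hsym : z0 ⬝ᵥ M.mulVec z = (a / s) * (m ⬝ᵥ z) := by
    rw [Matrix.dotProduct_mulVec, ← Matrix.mulVec_transpose, 
      show M.transpose = M from hM.isHermitian, hMz, smul_dotProduct, smul_eq_mul]
  have hzz : z ⬝ᵥ M.mulVec z = z ⬝ᵥ S⁻¹.mulVec z + a ^ 2 / s * (z ⬝ᵥ z) := by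
    rw [hMdef, Matrix.add_mulVec, Matrix.smul_mulVec, Matrix.one_mulVec, dotProduct_add, 
      dotProduct_smul, smul_eq_mul]
  rw [hTm, Matrix.mulVec_sub, hMz]
  simp only [sub_dotProduct, dotProduct_sub, dotProduct_smul, smul_dotProduct, smul_eq_mul, hsym, hzz]
  rw [dotProduct_comm z m, dotProduct_comm z0 m]
  field_simp
  ring

theorem gauss_conv_aux (n : ℕ) (S : Matrix (Fin n) (Fin n) ℝ) (hS : S.PosDef) (a s : ℝ) (hs : 0 < s)
    (x v : EuclideanSpace ℝ (Fin n)) :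
    ∫ y, gaussMat n S (y - v) * gaussKernel n s (x - a • y) =
      gaussMat n (a ^ 2 • S + s • (1 : Matrix (Fin n) (Fin n) ℝ)) (x - a • v) := by
  rw [← integral_add_right_eq_self _ v]
  obtain ⟨hM, hT, hdet, z0, hz0⟩ := sq_aux n S hS a s hs (x - a • v).ofLp
  set M := S⁻¹ + (a ^ 2 / s) • (1 : Matrix (Fin n) (Fin n) ℝ) with hMdef
  set T := a ^ 2 • S + s • (1 : Matrix (Fin n) (Fin n) ℝ) with hTdef
  have e : ∀ z : EuclideanSpace ℝ (Fin n), 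
      gaussMat n S (z + v - v) * gaussKernel n s (x - a • (z + v)) = 
      (((2 * π) ^ n * S.det) ^ (-(1 : ℝ) / 2) * (2 * π * s) ^ (-(n : ℝ) / 2) * 
        Real.exp (-((x - a • v).ofLp ⬝ᵥ T⁻¹.mulVec (x - a • v).ofLp) / 2)) * 
      (fun z : EuclideanSpace ℝ (Fin n) => Real.exp (-(z.ofLp ⬝ᵥ M.mulVec z.ofLp) / 2))
         (z - WithLp.toLp 2 z0) := by
    intro z
    have h := hz0 z.ofLp
    have hn : ‖x - a • (z + v)‖ ^ 2 = 
      ((x - a • v).ofLp - a • z.ofLp) ⬝ᵥ ((x - a • v).ofLp - a • z.ofLp) := by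
      rw [EuclideanSpace.real_norm_sq_eq]
      simp only [dotProduct]
      refine Finset.sum_congr rfl fun i _ => ?_
      simp
      ring
    unfold gaussMat gaussKernel
    rw [hn, add_sub_cancel_right]
    change _ * Real.exp (-(z.ofLp ⬝ᵥ S⁻¹.mulVec z.ofLp) / 2) * _ = _
    rw [mul_mul_mul_comm, ← Real.exp_add]
    simp only
    rw [mul_assoc _ (Real.exp _) (Real.exp _), ← Real.exp_add]
    congr 2
    simp only [WithLp.ofLp_sub]
    simp only [WithLp.ofLp_sub] at h
    have h3 : ∀ A B : ℝ, -A / 2 + -B / (2 * s) = -(A + B / s) / 2 := fun A B => by field_simp; ring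
    rw [h3, h]
    ring
  simp only [e]
  rw [integral_const_mul, integral_sub_right_eq_self 
    (fun z : EuclideanSpace ℝ (Fin n) => Real.exp (-(z.ofLp ⬝ᵥ M.mulVec z.ofLp) / 2)), 
    gauss_int_aux n M hM]
  unfold gaussMat
  change _ = _ * Real.exp (-((x - a • v).ofLp ⬝ᵥ T⁻¹.mulVec (x - a • v).ofLp) / 2)
  rw [mul_right_comm]
  congr 1
  rw [hdet]
  have hSd := hS.det_pos
  have hMd := hM.det_pos
  have hpi := Real.pi_pos
  rw [Real.mul_rpow (by positivity) hSd.le, Real.mul_rpow (x := 2 * π) (y := s) (by positivity) hs.le,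
    Real.mul_rpow (x := (2 * π) ^ n) (y := s ^ n * S.det * M.det) (by positivity) (by positivity),
    Real.mul_rpow (y := M.det) (by positivity) hMd.le,
    Real.mul_rpow (by positivity) hSd.le]
  have h5 : (2 * π) ^ (-(n : ℝ) / 2) * (2 * π) ^ ((n : ℝ) / 2) = 1 := by
    rw [← Real.rpow_add (by positivity)]; ring_nf; simp
  have h6 : (s ^ n) ^ (-(1 : ℝ) / 2) = s ^ (-(n : ℝ) / 2) := by
    rw [← Real.rpow_natCast, ← Real.rpow_mul hs.le]; ring_nf
  rw [h6]
  linear_combination (((2 * π) ^ n) ^ (-(1 : ℝ) / 2) * S.det ^ (-(1 : ℝ) / 2) * s ^ (-(n : ℝ) / 2) * M.det ^ (-(1 : ℝ) / 2)) * h5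

theorem gaussMat_cont (n : ℕ) (S : Matrix (Fin n) (Fin n) ℝ) : Continuous (gaussMat n S) := by
  unfold gaussMat
  simp only [Matrix.mulVec, dotProduct]
  fun_prop

theorem vp_aux (n : ℕ) (S : Matrix (Fin n) (Fin n) ℝ) (hS : S.PosDef)
    (μ : Measure (EuclideanSpace ℝ (Fin n))) [IsProbabilityMeasure μ]
    (pH : EuclideanSpace ℝ (Fin n) → ℝ)
    (hpH : ∀ x, pH x = ∫ y, gaussMat n S (x - y) ∂μ)
    (T : Matrix (Fin n) (Fin n) ℝ) (t : ℝ) (ht : 0 ≤ t)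
    (hT : T = Real.exp (-t) • S +
      (1 - Real.exp (-t)) • (1 : Matrix (Fin n) (Fin n) ℝ)) (x : EuclideanSpace ℝ (Fin n)) :
    vpMarginal n pH t x = ∫ y, gaussMat n T (x - Real.exp (-t / 2) • y) ∂μ := by
  rcases ht.eq_or_lt with rfl | ht
  · simp [vpMarginal, hpH, hT]
  have hs : 0 < 1 - Real.exp (-t) := by simpa using ht
  have ha : Real.exp (-t) = Real.exp (-t / 2) ^ 2 := by rw [← Real.exp_nat_mul]; ring_nf
  have hT' : T = Real.exp (-t / 2) ^ 2 • S +
      (1 - Real.exp (-t)) • (1 : Matrix (Fin n) (Fin n) ℝ) := by rw [hT, ← ha]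
  unfold vpMarginal
  rw [if_neg ht.ne']
  set s := 1 - Real.exp (-t)
  set a := Real.exp (-t / 2) with hadef
  have ha0 : a ≠ 0 := (Real.exp_pos _).ne'
  simp only [hpH, ← integral_mul_const]
  have hKi : Integrable (gaussKernel n s) := by
    unfold gaussKernel
    refine Integrable.const_mul ?_ _
    have h0 : (0 : ℝ) < 1 / (2 * s) := by positivity
    have := GaussianFourier.integral_rexp_neg_mul_sq_norm (V := EuclideanSpace ℝ (Fin n)) h0
    by_contra hcon
    have h1 : (fun v : EuclideanSpace ℝ (Fin n) => Real.exp (-(1 / (2 * s)) * ‖v‖ ^ 2)) =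
        fun z => Real.exp (-‖z‖ ^ 2 / (2 * s)) := by
      ext v; congr 1; ring
    rw [h1, integral_undef hcon] at this
    have h2 : 0 < (π / (1 / (2 * s))) ^ ((Module.finrank ℝ (EuclideanSpace ℝ (Fin n)) : ℝ) / 2) := by
      positivity
    exact h2.ne this
  have hKi' : Integrable (fun y => gaussKernel n s (x - a • y)) :=
    (hKi.comp_sub_left x).comp_smul ha0
  have hKc : Continuous (gaussKernel n s) := by unfold gaussKernel; fun_prop
  have hGc := gaussMat_cont n S
  have hbd : ∀ z, ‖gaussMat n S z‖ ≤ ((2 * π) ^ n * S.det) ^ (-(1 : ℝ) / 2) := by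
    intro z
    have hd := hS.det_pos
    unfold gaussMat
    rw [Real.norm_of_nonneg (by positivity)]
    refine mul_le_of_le_one_right (by positivity) (Real.exp_le_one_iff.2 ?_)
    have : 0 ≤ z.ofLp ⬝ᵥ S⁻¹.mulVec z.ofLp := by
      simpa using hS.inv.posSemidef.dotProduct_mulVec_nonneg z.ofLp
    have h2 : (∑ i, z i * S⁻¹.mulVec (fun j => z j) i) = z.ofLp ⬝ᵥ S⁻¹.mulVec z.ofLp := rfl
    rw [h2]
    linarith
  rw [integral_integral_swap]
  · refine integral_congr_ae (Eventually.of_forall fun v => ?_)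
    simp only
    rw [gauss_conv_aux n S hS a s hs x v, hT']
  · have h1 : Integrable (fun q : EuclideanSpace ℝ (Fin n) × EuclideanSpace ℝ (Fin n) => 
      gaussKernel n s (x - a • q.1)) (volume.prod μ) := hKi'.comp_fst μ
    refine h1.bdd_mul (f := fun q : EuclideanSpace ℝ (Fin n) × EuclideanSpace ℝ (Fin n) => 
      gaussMat n S (q.1 - q.2)) ?_ (Eventually.of_forall fun q => hbd _)
    exact (hGc.comp (continuous_fst.sub continuous_snd)).aestronglyMeasurable


/-- Explicit Hessian formula for `log p_t` when `p_H = φ_Σ ∗ μ` with compactly supported `μ`: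
`p_t(x) = ∫ φ_{S_t}(x - a(t) y) dμ(y) > 0` with `S_t = a(t)²Σ + σ²(t)I`, and
`∇² log p_t(x) = -S_t⁻¹ + a(t)² S_t⁻¹ Cov(μ_{t,x}) S_t⁻¹`. -/
theorem stmt_8 (n : ℕ) (S : Matrix (Fin n) (Fin n) ℝ) (hS : S.PosDef)
    (μ : Measure (EuclideanSpace ℝ (Fin n))) [IsProbabilityMeasure μ]
    (hsupp : ∃ Kc : Set (EuclideanSpace ℝ (Fin n)), IsCompact Kc ∧ μ Kcᶜ = 0)
    (pH : EuclideanSpace ℝ (Fin n) → ℝ)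
    (hpH : ∀ x, pH x = ∫ y, gaussMat n S (x - y) ∂μ)
    (St : ℝ → Matrix (Fin n) (Fin n) ℝ)
    (hSt : ∀ t, St t = Real.exp (-t) • S +
      (1 - Real.exp (-t)) • (1 : Matrix (Fin n) (Fin n) ℝ)) :
    ∀ t ≥ (0 : ℝ), ∀ x,
      (vpMarginal n pH t x =
          ∫ y, gaussMat n (St t) (x - Real.exp (-t / 2) • y) ∂μ ∧
        0 < vpMarginal n pH t x) ∧
      (TwiceDiff (fun z => Real.log (vpMarginal n pH t z)) ∧
        ∀ u w : EuclideanSpace ℝ (Fin n),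
          hessian (fun z => Real.log (vpMarginal n pH t z)) x u w =
            ∑ i, ∑ j, u i *
              ((-(St t)⁻¹ + Real.exp (-t) •
                ((St t)⁻¹ *
                  covMatrix n (postMeasure n μ (St t) (Real.exp (-t / 2))
                    (vpMarginal n pH t x) x) *
                  (St t)⁻¹)) i j) * w j) := by
  intro t ht x
  obtain ⟨K, hK, hμK⟩ := hsupp
  have hv := vp_aux n S hS μ pH hpH (St t) t ht (hSt t)
  have he1 : Real.exp (-t) ≤ 1 := by simpa using ht
  have ha : Real.exp (-t) = Real.exp (-t / 2) ^ 2 := by rw [← Real.exp_nat_mul]; ring_nf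
  have hT : (St t).PosDef := by
    rw [hSt]
    exact (hS.smul (Real.exp_pos _)).add_posSemidef
      (Matrix.PosSemidef.one.smul (by linarith))
  generalize St t = T at *
  set a := Real.exp (-t / 2) with hadef
  set p := fun z => vpMarginal n pH t z with hpdef
  change (p x = _ ∧ 0 < p x) ∧ _ ∧ ∀ u w : EuclideanSpace ℝ (Fin n), _ = ∑ i, ∑ j, u i * ((-T⁻¹ + Real.exp (-t) • 
    (T⁻¹ * covMatrix n (postMeasure n μ T a (p x) x) * T⁻¹)) i j) * w j
  have hsymT : (T⁻¹).transpose = T⁻¹ := hT.inv.isHermitian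
  set L : EuclideanSpace ℝ (Fin n) →L[ℝ] EuclideanSpace ℝ (Fin n) :=
    LinearMap.toContinuousLinearMap (Matrix.toEuclideanLin T⁻¹) with hL
  have hLap : ∀ z, (L z).ofLp = T⁻¹.mulVec z.ofLp := fun z => rfl
  set b : EuclideanSpace ℝ (Fin n) →L[ℝ] EuclideanSpace ℝ (Fin n) →L[ℝ] ℝ :=
    (innerSL ℝ).comp L with hbdef
  have hb : ∀ z w, b z w = w.ofLp ⬝ᵥ T⁻¹.mulVec z.ofLp := by
    intro z w
    rw [← hLap]
    simp [hbdef, PiLp.inner_apply, dotProduct]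
  have hbs : ∀ u v, b u v = b v u := by
    intro u v
    rw [hb, hb, Matrix.dotProduct_mulVec, ← Matrix.mulVec_transpose, hsymT, dotProduct_comm]
  have hd := hT.det_pos
  obtain ⟨h1, h2, h3⟩ := hess_aux μ K hK hμK a (((2 * π) ^ n * T.det) ^ (-(1 : ℝ) / 2))
    (by positivity) b hbs (gaussMat n T) (fun z => by rw [hb]; rfl) p hv
  refine ⟨⟨hv x, h1 x⟩, h2, fun u w => ?_⟩
  rw [h3 x u w]
  change _ + a ^ 2 * ((∫ y, b y u * b y w ∂(postMeasure n μ T a (p x) x)) -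
    (∫ y, b y u ∂(postMeasure n μ T a (p x) x)) * (∫ y, b y w ∂(postMeasure n μ T a (p x) x))) = _
  have hGc := gaussMat_cont n T
  have hfin : IsFiniteMeasure (postMeasure n μ T a (p x) x) := by
    unfold postMeasure
    exact isFiniteMeasure_withDensity_ofReal 
      (int_aux μ K hK hμK (fun y => gaussMat n T (x - a • y) / p x) (by fun_prop)).2
  have hνK : (postMeasure n μ T a (p x) x) Kᶜ = 0 := withDensity_absolutelyContinuous _ _ hμK
  generalize postMeasure n μ T a (p x) x = ν at *
  have hint : ∀ f : EuclideanSpace ℝ (Fin n) → ℝ, Continuous f → Integrable f ν := 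
    fun f hf => int_aux ν K hK hνK f hf
  set U := T⁻¹.mulVec u.ofLp with hU
  set W := T⁻¹.mulVec w.ofLp with hW
  have hbU : ∀ y, b y u = ∑ i, U i * y i := fun y => by
    rw [hbs, hb, dotProduct_comm]; rfl
  have hbW : ∀ y, b y w = ∑ i, W i * y i := fun y => by
    rw [hbs, hb, dotProduct_comm]; rfl
  have i1 : ∀ V : Fin n → ℝ, ∫ y : EuclideanSpace ℝ (Fin n), ∑ i, V i * y i ∂ν =
      ∑ i, V i * ∫ y, y i ∂ν := by
    intro V
    rw [integral_finsetSum _ fun i _ => hint _ (by fun_prop)]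
    simp only [integral_const_mul]
  have i2 : ∫ y : EuclideanSpace ℝ (Fin n), (∑ i, U i * y i) * ∑ j, W j * y j ∂ν =
      ∑ i, ∑ j, U i * W j * ∫ y, y i * y j ∂ν := by
    simp only [Finset.sum_mul_sum]
    rw [integral_finsetSum _ fun i _ => hint _ (by fun_prop)]
    refine Finset.sum_congr rfl fun i _ => ?_
    rw [integral_finsetSum _ fun i _ => hint _ (by fun_prop)]
    refine Finset.sum_congr rfl fun j _ => ?_
    rw [← integral_const_mul]
    refine integral_congr_ae (Eventually.of_forall fun y => ?_)
    simp only
    ring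
  have hr : ∀ A : Matrix (Fin n) (Fin n) ℝ, ∑ i, ∑ j, u i * A i j * w j = 
      u.ofLp ⬝ᵥ A.mulVec w.ofLp := by
    intro A
    simp only [dotProduct, Matrix.mulVec, Finset.mul_sum, mul_assoc]
  have hcov : U ⬝ᵥ (covMatrix n ν).mulVec W = 
     (∑ i, ∑ j, U i * W j * ∫ y, y i * y j ∂ν) - 
      (∑ i, U i * ∫ y, y i ∂ν) * (∑ j, W j * ∫ y, y j ∂ν) := by
    rw [Finset.sum_mul_sum]
    simp only [← Finset.sum_sub_distrib, dotProduct, Matrix.mulVec, 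
      Finset.mul_sum, covMatrix, Matrix.of_apply]
    refine Finset.sum_congr rfl fun i _ => Finset.sum_congr rfl fun j _ => ?_
    ring
  rw [hr, Matrix.add_mulVec, Matrix.neg_mulVec, Matrix.smul_mulVec, dotProduct_add, dotProduct_neg,
    dotProduct_smul, smul_eq_mul, hbs u w, hb w u, ← Matrix.mulVec_mulVec, ← Matrix.mulVec_mulVec, 
    Matrix.dotProduct_mulVec _ T⁻¹ ((covMatrix n ν).mulVec _),
    ← Matrix.mulVec_transpose, hsymT, ← hU, ← hW, hcov, ha]
  simp only [hbU, hbW, i1, i2]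
end

section
/- Let p_H be a compactly supported probability density on ℝ^n. Then for every ε > 0 there exist 0 < δ < T < ∞ such that every bijection φ : ℝ^n → ℝ^n which is a flow map of v from time δ to time T and transports p_δ to p_T is bi-Lipschitz and satisfies ‖p_H·λ − (φ^{-1})_# γ_n‖_TV < ε. -/
open MeasureTheory Real Filter Set
open scoped ENNReal Topology RealInnerProductSpace Classical

section Aux

theorem aux_integrable_s9 {n : ℕ} {F : Type*} [NormedAddCommGroup F] [NormedSpace ℝ F]
    {w : EuclideanSpace ℝ (Fin n) → ℝ} (hw : Integrable w) {R : ℝ}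
    (hR : ∀ y, R < ‖y‖ → w y = 0) {g : EuclideanSpace ℝ (Fin n) → F} (hg : Continuous g) :
    Integrable (fun y => w y • g y) := by
  obtain ⟨C, hC⟩ := (isCompact_closedBall (0 : EuclideanSpace ℝ (Fin n)) R).exists_bound_of_continuousOn
    hg.continuousOn
  refine (hw.norm.mul_const C).mono' (hw.aestronglyMeasurable.smul hg.aestronglyMeasurable) ?_
  refine Eventually.of_forall fun y => ?_
  rw [norm_smul]
  by_cases h : R < ‖y‖
  · simp [hR y h]
  · exact mul_le_mul_of_nonneg_left (hC y (by simpa using h)) (norm_nonneg _)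

noncomputable def ZZ {n : ℕ} (w : EuclideanSpace ℝ (Fin n) → ℝ) (u : EuclideanSpace ℝ (Fin n)) : ℝ :=
  ∫ y, w y • Real.exp ⟪u, y⟫

noncomputable def NN {n : ℕ} (w : EuclideanSpace ℝ (Fin n) → ℝ) (u : EuclideanSpace ℝ (Fin n)) :
    EuclideanSpace ℝ (Fin n) :=
  ∫ y, w y • Real.exp ⟪u, y⟫ • y

theorem ZZ_grad {n : ℕ}
    {w : EuclideanSpace ℝ (Fin n) → ℝ} (hw : Integrable w) {R : ℝ}
    (hR : ∀ y, R < ‖y‖ → w y = 0) (u : EuclideanSpace ℝ (Fin n)) :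
    HasGradientAt (ZZ w) (NN w u) u := by
  rw [hasGradientAt_iff_hasFDerivAt]
  have key := hasFDerivAt_integral_of_dominated_of_fderiv_le (𝕜 := ℝ) (μ := volume)
    (F := fun u y => w y • Real.exp ⟪u, y⟫)
    (F' := fun u y => w y • Real.exp ⟪u, y⟫ • InnerProductSpace.toDual ℝ (EuclideanSpace ℝ (Fin n)) y)
    (x₀ := u) (s := Metric.ball u 1) (bound := fun y => |w y| * (Real.exp ((‖u‖ + 1) * R) * R))
    (Metric.ball_mem_nhds u one_pos)
    (Eventually.of_forall fun u => (aux_integrable_s9 hw hR (by fun_prop)).aestronglyMeasurable)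
    (aux_integrable_s9 hw hR (by fun_prop))
    (aux_integrable_s9 hw hR (by fun_prop)).aestronglyMeasurable
    ?_ (hw.abs.mul_const _) ?_
  · have e : InnerProductSpace.toDual ℝ (EuclideanSpace ℝ (Fin n)) (NN w u) = ∫ y, w y • Real.exp ⟪u, y⟫ •
        InnerProductSpace.toDual ℝ (EuclideanSpace ℝ (Fin n)) y := ?_
    · rw [e]; exact key
    have : NN w u = ∫ y, w y • Real.exp ⟪u, y⟫ • y := rfl
    rw [this]
    have h2 := ((InnerProductSpace.toDual ℝ (EuclideanSpace ℝ (Fin n))).toContinuousLinearEquiv.toContinuousLinearMap.integral_comp_comm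
      (aux_integrable_s9 hw hR (g := fun y => Real.exp ⟪u, y⟫ • y) (by fun_prop)))
    simpa using h2.symm
  · refine Eventually.of_forall fun y x hx => ?_
    by_cases h : R < ‖y‖
    · simp [hR y h]
    · push Not at h
      rw [norm_smul, norm_smul, LinearIsometryEquiv.norm_map, Real.norm_eq_abs, Real.norm_eq_abs,
        Real.abs_exp]
      refine mul_le_mul_of_nonneg_left ?_ (abs_nonneg _)
      refine mul_le_mul (Real.exp_le_exp.2 ?_) h (norm_nonneg _) (Real.exp_pos _).le
      refine (real_inner_le_norm _ _).trans (mul_le_mul ?_ h (norm_nonneg _) (by positivity))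
      have : ‖x - u‖ < 1 := by simpa [dist_eq_norm] using hx
      have := norm_le_norm_add_norm_sub' x u
      linarith
  · refine Eventually.of_forall fun y x _ => ?_
    have h1 : HasFDerivAt (fun x : EuclideanSpace ℝ (Fin n) => ⟪x, y⟫)
        (InnerProductSpace.toDual ℝ (EuclideanSpace ℝ (Fin n)) y) x := by
      have := (InnerProductSpace.toDual ℝ (EuclideanSpace ℝ (Fin n)) y).hasFDerivAt (x := x)
      refine this.congr_of_eventuallyEq (Eventually.of_forall fun z => ?_)
      simp [real_inner_comm]
    exact (h1.exp.const_smul (w y))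

theorem ZZ_pos {n : ℕ}
    {w : EuclideanSpace ℝ (Fin n) → ℝ} (hw : Integrable w) {R : ℝ} 
    (hR : ∀ y, R < ‖y‖ → w y = 0) (hnn : ∀ y, 0 ≤ w y) (hpos : 0 < ∫ y, w y)
    (u : EuclideanSpace ℝ (Fin n)) : 0 < ZZ w u := by
  have : (∫ y, w y) * Real.exp (-(‖u‖ * R)) ≤ ZZ w u := by
    rw [← integral_mul_const]
    refine integral_mono (hw.mul_const _) (aux_integrable_s9 hw hR (by fun_prop)) fun y => ?_
    by_cases h : R < ‖y‖
    · simp [hR y h]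
    · push Not at h
      refine mul_le_mul_of_nonneg_left (Real.exp_le_exp.2 ?_) (hnn y)
      have h1 := abs_real_inner_le_norm u y
      have h2 := mul_le_mul_of_nonneg_left h (norm_nonneg u)
      have := neg_abs_le ⟪u, y⟫
      linarith
  exact lt_of_lt_of_le (by positivity) this

theorem exp_sub_le (p q : ℝ) : |Real.exp p - Real.exp q| ≤ |p - q| * (Real.exp p + Real.exp q) := by
  wlog h : q ≤ p generalizing p q
  · rw [abs_sub_comm, abs_sub_comm p q, add_comm]
    exact this q p (by linarith)
  rw [abs_of_nonneg (by linarith [Real.exp_le_exp.2 h]), abs_of_nonneg (by linarith)]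
  have h1 : (q - p) + 1 ≤ Real.exp (q - p) := Real.add_one_le_exp _
  have h2 : Real.exp q = Real.exp p * Real.exp (q - p) := by rw [← Real.exp_add]; ring_nf
  have h3 := Real.exp_pos p
  have h4 := Real.exp_pos q
  have h5 : Real.exp p - Real.exp q ≤ Real.exp p * (p - q) := by
    rw [h2]; nlinarith
  have h6 : 0 ≤ (p - q) * Real.exp q := mul_nonneg (by linarith) h4.le
  linarith

theorem ZZ_diff {n : ℕ}
    {w : EuclideanSpace ℝ (Fin n) → ℝ} (hw : Integrable w) {R : ℝ}
    (hR : ∀ y, R < ‖y‖ → w y = 0) (hnn : ∀ y, 0 ≤ w y)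
    (u v : EuclideanSpace ℝ (Fin n)) : |ZZ w u - ZZ w v| ≤ ‖u - v‖ * R * (ZZ w u + ZZ w v) := by
  have hi := fun u : EuclideanSpace ℝ (Fin n) => 
    aux_integrable_s9 hw hR (g := fun y => Real.exp ⟪u, y⟫) (by fun_prop)
  unfold ZZ
  rw [← integral_sub (hi u) (hi v), ← integral_add (hi u) (hi v), ← integral_const_mul, ← Real.norm_eq_abs]
  refine norm_integral_le_of_norm_le (((hi u).fun_add (hi v)).const_mul _) (Eventually.of_forall fun y => ?_)
  by_cases h : R < ‖y‖
  · simp [hR y h]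
  push Not at h
  simp only [smul_eq_mul]
  rw [← mul_sub, norm_mul, Real.norm_eq_abs, Real.norm_eq_abs, abs_of_nonneg (hnn y)]
  have h1 := exp_sub_le ⟪u, y⟫ ⟪v, y⟫
  rw [← inner_sub_left] at h1
  have h2 : |⟪u - v, y⟫| ≤ ‖u - v‖ * R :=
    (abs_real_inner_le_norm _ _).trans (mul_le_mul_of_nonneg_left h (norm_nonneg _))
  have h3 := h1.trans (mul_le_mul_of_nonneg_right h2 (by positivity))
  have := mul_le_mul_of_nonneg_left h3 (hnn y)
  linarith

theorem NN_diff {n : ℕ}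
    {w : EuclideanSpace ℝ (Fin n) → ℝ} (hw : Integrable w) {R : ℝ}
    (hR : ∀ y, R < ‖y‖ → w y = 0) (hnn : ∀ y, 0 ≤ w y)
    (u v : EuclideanSpace ℝ (Fin n)) :
    ‖NN w u - NN w v‖ ≤ R * (‖u - v‖ * R * (ZZ w u + ZZ w v)) := by
  have hi := fun u : EuclideanSpace ℝ (Fin n) => 
    aux_integrable_s9 hw hR (g := fun y => Real.exp ⟪u, y⟫) (by fun_prop)
  have hj := fun u : EuclideanSpace ℝ (Fin n) => 
    aux_integrable_s9 hw hR (g := fun y => Real.exp ⟪u, y⟫ • y) (by fun_prop)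
  unfold ZZ NN
  rw [← integral_sub (hj u) (hj v), ← integral_add (hi u) (hi v), ← mul_assoc, ← integral_const_mul]
  refine norm_integral_le_of_norm_le (((hi u).fun_add (hi v)).const_mul _) (Eventually.of_forall fun y => ?_)
  by_cases h : R < ‖y‖
  · simp [hR y h]
  push Not at h
  simp only [smul_eq_mul]
  rw [← smul_sub, ← sub_smul, norm_smul, norm_smul, Real.norm_eq_abs, Real.norm_eq_abs, abs_of_nonneg (hnn y)]
  have h1 := exp_sub_le ⟪u, y⟫ ⟪v, y⟫
  rw [← inner_sub_left] at h1
  have h2 : |⟪u - v, y⟫| ≤ ‖u - v‖ * R :=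
    (abs_real_inner_le_norm _ _).trans (mul_le_mul_of_nonneg_left h (norm_nonneg _))
  have h3 := h1.trans (mul_le_mul_of_nonneg_right h2 (by positivity))
  have h4 := mul_le_mul h3 h (norm_nonneg _) ((abs_nonneg _).trans h3)
  have := mul_le_mul_of_nonneg_left h4 (hnn y)
  linarith

theorem NN_le {n : ℕ}
    {w : EuclideanSpace ℝ (Fin n) → ℝ} (hw : Integrable w) {R : ℝ}
    (hR : ∀ y, R < ‖y‖ → w y = 0) (hnn : ∀ y, 0 ≤ w y)
    (u : EuclideanSpace ℝ (Fin n)) : ‖NN w u‖ ≤ R * ZZ w u := by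
  have hi := fun u : EuclideanSpace ℝ (Fin n) => 
    aux_integrable_s9 hw hR (g := fun y => Real.exp ⟪u, y⟫) (by fun_prop)
  unfold ZZ NN
  rw [← integral_const_mul]
  refine norm_integral_le_of_norm_le ((hi u).const_mul _) (Eventually.of_forall fun y => ?_)
  by_cases h : R < ‖y‖
  · simp [hR y h]
  push Not at h
  rw [norm_smul, norm_smul, Real.norm_eq_abs, Real.norm_eq_abs, abs_of_nonneg (hnn y), Real.abs_exp,
    smul_eq_mul, ← mul_assoc, mul_comm R]
  exact mul_le_mul_of_nonneg_left h (mul_nonneg (hnn y) (Real.exp_pos _).le)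

theorem mean_lip {n : ℕ}
    {w : EuclideanSpace ℝ (Fin n) → ℝ} (hw : Integrable w) {R : ℝ} (hR0 : 0 ≤ R)
    (hR : ∀ y, R < ‖y‖ → w y = 0) (hnn : ∀ y, 0 ≤ w y) (hpos : 0 < ∫ y, w y)
    (u v : EuclideanSpace ℝ (Fin n)) :
    ‖(ZZ w u)⁻¹ • NN w u - (ZZ w v)⁻¹ • NN w v‖ ≤ 4 * R ^ 2 * ‖u - v‖ := by
  wlog h : ZZ w v ≤ ZZ w u generalizing u v
  · rw [norm_sub_rev, norm_sub_rev u v]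
    exact this v u (by linarith)
  have hu := ZZ_pos hw hR hnn hpos u
  have hv := ZZ_pos hw hR hnn hpos v
  have e : (ZZ w u)⁻¹ • NN w u - (ZZ w v)⁻¹ • NN w v =
      (ZZ w u)⁻¹ • (NN w u - NN w v) + ((ZZ w u)⁻¹ * (ZZ w v - ZZ w u) * (ZZ w v)⁻¹) • NN w v := by
    have : (ZZ w u)⁻¹ * (ZZ w v - ZZ w u) * (ZZ w v)⁻¹ = (ZZ w u)⁻¹ - (ZZ w v)⁻¹ := by
      field_simp
    rw [this, smul_sub, sub_smul]; abel
  rw [e]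
  have h1 := NN_diff hw hR hnn u v
  have h2 := ZZ_diff hw hR hnn u v
  have h3 := NN_le hw hR hnn v
  have h4 : ZZ w u + ZZ w v ≤ 2 * ZZ w u := by linarith
  have h5 : ‖u - v‖ * R * (ZZ w u + ZZ w v) ≤ ‖u - v‖ * R * (2 * ZZ w u) :=
    mul_le_mul_of_nonneg_left h4 (by positivity)
  have a1 : ‖(ZZ w u)⁻¹ • (NN w u - NN w v)‖ ≤ 2 * R ^ 2 * ‖u - v‖ := by
    rw [norm_smul, Real.norm_eq_abs, abs_of_pos (inv_pos.2 hu), inv_mul_le_iff₀ hu]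
    have := h1.trans (mul_le_mul_of_nonneg_left h5 hR0)
    linarith
  have a2 : ‖((ZZ w u)⁻¹ * (ZZ w v - ZZ w u) * (ZZ w v)⁻¹) • NN w v‖ ≤ 2 * R ^ 2 * ‖u - v‖ := by
    rw [norm_smul, Real.norm_eq_abs, abs_mul, abs_mul, abs_of_pos (inv_pos.2 hu),
      abs_of_pos (inv_pos.2 hv), abs_sub_comm]
    have b1 : (ZZ w u)⁻¹ * |ZZ w u - ZZ w v| ≤ 2 * R * ‖u - v‖ := by
      rw [inv_mul_le_iff₀ hu]; linarith
    have b2 : (ZZ w v)⁻¹ * ‖NN w v‖ ≤ R := by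
      rw [inv_mul_le_iff₀ hv]; linarith
    rw [mul_assoc]
    have := mul_le_mul b1 b2 (by positivity) (by positivity)
    linarith
  linarith [norm_add_le ((ZZ w u)⁻¹ • (NN w u - NN w v)) (((ZZ w u)⁻¹ * (ZZ w v - ZZ w u) * (ZZ w v)⁻¹) • NN w v)]

noncomputable def WW {n : ℕ} (pH : EuclideanSpace ℝ (Fin n) → ℝ) (a s : ℝ)
    (y : EuclideanSpace ℝ (Fin n)) : ℝ := pH y * Real.exp (-(a ^ 2 * ‖y‖ ^ 2) / (2 * s))

theorem conv_eq {n : ℕ} (pH : EuclideanSpace ℝ (Fin n) → ℝ) (a : ℝ) {s : ℝ} (hs : 0 < s)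
    (x : EuclideanSpace ℝ (Fin n)) :
    ∫ y, pH y * gaussKernel n s (x - a • y) =
      (2 * π * s) ^ (-(n : ℝ) / 2) * Real.exp (-‖x‖ ^ 2 / (2 * s)) * ZZ (WW pH a s) ((a / s) • x) := by
  unfold ZZ
  rw [← integral_const_mul]
  congr 1; ext y
  unfold gaussKernel WW
  rw [norm_sub_sq_real, inner_smul_right, norm_smul, mul_pow, Real.norm_eq_abs, sq_abs, smul_eq_mul,
    real_inner_smul_left]
  have : Real.exp (-(‖x‖ ^ 2 - 2 * (a * ⟪x, y⟫) + a ^ 2 * ‖y‖ ^ 2) / (2 * s)) =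
    Real.exp (-‖x‖ ^ 2 / (2 * s)) * (Real.exp (-(a ^ 2 * ‖y‖ ^ 2) / (2 * s)) *
      Real.exp (a / s * ⟪x, y⟫)) := by
    rw [← Real.exp_add, ← Real.exp_add]
    congr 1
    field_simp
    ring
  rw [this]; ring

theorem WW_int {n : ℕ} {pH : EuclideanSpace ℝ (Fin n) → ℝ} (hint : Integrable pH) {R : ℝ}
    (hR : ∀ y, R < ‖y‖ → pH y = 0) (a s : ℝ) : Integrable (WW pH a s) :=
  aux_integrable_s9 hint hR (g := fun y => Real.exp (-(a ^ 2 * ‖y‖ ^ 2) / (2 * s))) (by fun_prop)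

theorem WW_pos {n : ℕ} {pH : EuclideanSpace ℝ (Fin n) → ℝ} (hint : Integrable pH) {R : ℝ}
    (hR : ∀ y, R < ‖y‖ → pH y = 0) (hnn : ∀ x, 0 ≤ pH x) (hpos : 0 < ∫ y, pH y) (a : ℝ) {s : ℝ}
    (hs : 0 < s) : 0 < ∫ y, WW pH a s y := by
  have hw := WW_int hint hR a s
  have : (∫ y, pH y) * Real.exp (-(a ^ 2 * R ^ 2) / (2 * s)) ≤ ∫ y, WW pH a s y := by
    rw [← integral_mul_const]
    refine integral_mono (hint.mul_const _) hw fun y => ?_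
    by_cases h : R < ‖y‖
    · simp [hR y h, WW]
    · push Not at h
      refine mul_le_mul_of_nonneg_left (Real.exp_le_exp.2 ?_) (hnn y)
      gcongr
  exact lt_of_lt_of_le (by positivity) this

theorem conv_cont {n : ℕ} {pH : EuclideanSpace ℝ (Fin n) → ℝ} (hint : Integrable pH) {R : ℝ}
    (hR : ∀ y, R < ‖y‖ → pH y = 0) (a : ℝ) {s : ℝ} (hs : 0 < s) :
    Continuous (fun x => ∫ y, pH y * gaussKernel n s (x - a • y)) := by
  have hR' : ∀ y, R < ‖y‖ → WW pH a s y = 0 := fun y h => by simp [WW, hR y h]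
  have : Continuous (ZZ (WW pH a s)) := continuous_iff_continuousAt.2 fun u =>
    (ZZ_grad (WW_int hint hR a s) hR' u).hasFDerivAt.continuousAt
  simp_rw [conv_eq pH a hs]
  fun_prop

theorem score_eq {n : ℕ} {pH : EuclideanSpace ℝ (Fin n) → ℝ} (hint : Integrable pH) {R : ℝ}
    (hR : ∀ y, R < ‖y‖ → pH y = 0) (hnn : ∀ x, 0 ≤ pH x) (hpos : 0 < ∫ y, pH y) (a : ℝ) {s : ℝ}
    (hs : 0 < s) (x : EuclideanSpace ℝ (Fin n)) :
    gradient (fun x => Real.log (∫ y, pH y * gaussKernel n s (x - a • y))) x =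
      -(s⁻¹ • x) + (a / s) • ((ZZ (WW pH a s) ((a / s) • x))⁻¹ • NN (WW pH a s) ((a / s) • x)) := by
  have hR' : ∀ y, R < ‖y‖ → WW pH a s y = 0 := fun y h => by simp [WW, hR y h]
  have hnn' : ∀ y, 0 ≤ WW pH a s y := fun y => mul_nonneg (hnn y) (Real.exp_pos _).le
  have hw := WW_int hint hR a s
  have hZ := fun u => ZZ_pos hw hR' hnn' (WW_pos hint hR hnn hpos a hs) u
  apply HasGradientAt.gradient
  have e : (fun x => Real.log (∫ y, pH y * gaussKernel n s (x - a • y))) =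
      fun x => Real.log ((2 * π * s) ^ (-(n : ℝ) / 2)) + (-(2 * s)⁻¹) * ‖x‖ ^ 2 +
        Real.log (ZZ (WW pH a s) ((a / s) • x)) := by
    ext x
    rw [conv_eq pH a hs, Real.log_mul (by positivity) (hZ _).ne',
      Real.log_mul (by positivity) (by positivity), Real.log_exp]
    ring
  rw [e, hasGradientAt_iff_hasFDerivAt]
  have h1 := ((hasStrictFDerivAt_norm_sq x).hasFDerivAt.const_mul (-(2 * s)⁻¹)).const_add
    (Real.log ((2 * π * s) ^ (-(n : ℝ) / 2)))
  have h2 := ((ZZ_grad hw hR' ((a / s) • x)).hasFDerivAt.comp x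
    ((hasFDerivAt_id x).const_smul (a / s))).log (hZ _).ne'
  refine (h1.add h2).congr_fderiv ?_
  ext v
  simp
  field_simp

theorem score_lip {n : ℕ} {pH : EuclideanSpace ℝ (Fin n) → ℝ} (hint : Integrable pH) {R : ℝ}
    (hR0 : 0 ≤ R)
    (hR : ∀ y, R < ‖y‖ → pH y = 0) (hnn : ∀ x, 0 ≤ pH x) (hpos : 0 < ∫ y, pH y) {δ t : ℝ}
    (hδ : 0 < δ) (ht : δ ≤ t) (x x' : EuclideanSpace ℝ (Fin n)) :
    ‖vField n pH t x - vField n pH t x'‖ ≤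
      (1 + (1 - Real.exp (-δ))⁻¹ + 4 * R ^ 2 * (1 - Real.exp (-δ))⁻¹ ^ 2) * ‖x - x'‖ := by
  have ht0 : t ≠ 0 := by linarith
  have hs0 : 0 < 1 - Real.exp (-δ) := by
    have : Real.exp (-δ) < 1 := by simpa using hδ
    linarith
  have hs1 : 1 - Real.exp (-δ) ≤ 1 - Real.exp (-t) := by
    have := Real.exp_le_exp.2 (neg_le_neg ht)
    linarith
  have hs : 0 < 1 - Real.exp (-t) := lt_of_lt_of_le hs0 hs1
  have ha : Real.exp (-t / 2) ≤ 1 := Real.exp_le_one_iff.2 (by linarith)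
  have ha0 := Real.exp_pos (-t / 2)
  have hinv : (1 - Real.exp (-t))⁻¹ ≤ (1 - Real.exp (-δ))⁻¹ := inv_anti₀ hs0 hs1
  have hsc := fun x => score_eq hint hR hnn hpos (Real.exp (-t / 2)) hs x
  unfold vField score
  simp only [vpMarginal, if_neg ht0]
  rw [hsc, hsc]
  generalize 1 - Real.exp (-t) = s at *
  generalize Real.exp (-t / 2) = a at *
  generalize 1 - Real.exp (-δ) = s' at *
  have hR' : ∀ y, R < ‖y‖ → WW pH a s y = 0 := fun y h => by simp [WW, hR y h]
  have hnn' : ∀ y, 0 ≤ WW pH a s y := fun y => mul_nonneg (hnn y) (Real.exp_pos _).le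
  have hm := mean_lip (WW_int hint hR a s) hR0 hR' hnn' (WW_pos hint hR hnn hpos a hs) ((a / s) • x)
    ((a / s) • x')
  rw [← smul_sub, norm_smul, Real.norm_eq_abs, abs_of_nonneg (by positivity)] at hm
  generalize (ZZ (WW pH a s) ((a / s) • x))⁻¹ • NN (WW pH a s) ((a / s) • x) = m at *
  generalize (ZZ (WW pH a s) ((a / s) • x'))⁻¹ • NN (WW pH a s) ((a / s) • x') = m' at *
  have e : -(2 : ℝ)⁻¹ • x - (2 : ℝ)⁻¹ • (-(s⁻¹ • x) + (a / s) • m) -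
      (-(2 : ℝ)⁻¹ • x' - (2 : ℝ)⁻¹ • (-(s⁻¹ • x') + (a / s) • m')) =
      (2⁻¹ * (s⁻¹ - 1)) • (x - x') + (-(2⁻¹ * (a / s))) • (m - m') := by
    module
  rw [e]
  have has : a / s ≤ s'⁻¹ := by
    rw [div_eq_mul_inv]
    calc a * s⁻¹ ≤ 1 * s'⁻¹ := mul_le_mul ha hinv (by positivity) (by positivity)
      _ = _ := one_mul _
  have has0 : 0 ≤ a / s := by positivity
  refine (norm_add_le _ _).trans ?_
  rw [norm_smul, norm_smul, Real.norm_eq_abs, Real.norm_eq_abs, abs_neg, abs_of_nonneg (a := 2⁻¹ * (a / s)) (by positivity)]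
  have b1 : |2⁻¹ * (s⁻¹ - 1)| ≤ 1 + s'⁻¹ := by
    have : 0 < s⁻¹ := by positivity
    rw [abs_le]; constructor <;> linarith
  have b2 : 2⁻¹ * (a / s) * ‖m - m'‖ ≤ 4 * R ^ 2 * s'⁻¹ ^ 2 * ‖x - x'‖ := by
    have c1 : ‖m - m'‖ ≤ 4 * R ^ 2 * (s'⁻¹ * ‖x - x'‖) := hm.trans (by gcongr)
    calc 2⁻¹ * (a / s) * ‖m - m'‖ ≤ s'⁻¹ * (4 * R ^ 2 * (s'⁻¹ * ‖x - x'‖)) :=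
          mul_le_mul (by linarith) c1 (norm_nonneg _) (by positivity)
      _ = _ := by ring
  have := mul_le_mul_of_nonneg_right b1 (norm_nonneg (x - x'))
  linarith

theorem flow_bilip {n : ℕ} {v : ℝ → EuclideanSpace ℝ (Fin n) → EuclideanSpace ℝ (Fin n)} {δ T K : ℝ}
    (hδT : δ < T) (hK : 0 ≤ K) (hv : ∀ t, δ ≤ t → ∀ x x', ‖v t x - v t x'‖ ≤ K * ‖x - x'‖)
    {φ : EuclideanSpace ℝ (Fin n) → EuclideanSpace ℝ (Fin n)} (hφ : IsFlowMap n v δ T φ) :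
    BiLipschitz φ := by
  refine ⟨Real.exp (-(K * (T - δ))), Real.exp (K * (T - δ)), Real.exp_pos _, ?_, fun x y => ?_⟩
  · have : 0 ≤ K * (T - δ) := mul_nonneg hK (by linarith)
    exact Real.exp_le_exp.2 (by linarith)
  obtain ⟨f, hf0, hf, hfT⟩ := hφ x
  obtain ⟨g, hg0, hg, hgT⟩ := hφ y
  lift K to NNReal using hK
  have hL : ∀ t, δ ≤ t → LipschitzWith K (v t) := fun t ht =>
    LipschitzWith.of_dist_le_mul fun x y => by simpa [dist_eq_norm] using hv t ht x y
  constructor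
  · have hm : ∀ t ∈ Icc δ T, δ + T - t ∈ Icc δ T := fun t ht => ⟨by linarith [ht.2], by linarith [ht.1]⟩
    have hd : ∀ (f : ℝ → EuclideanSpace ℝ (Fin n)), (∀ t ∈ Icc δ T, HasDerivAt f (v t (f t)) t) →
        ∀ t ∈ Icc δ T, HasDerivAt (fun t => f (δ + T - t)) (-(v (δ + T - t) (f (δ + T - t)))) t := by
      intro f hf t ht
      have := (hf _ (hm t ht)).scomp t ((hasDerivAt_id t).const_sub (δ + T))
      rw [neg_one_smul] at this
      exact this
    have := dist_le_of_trajectories_ODE_of_mem (v := fun t x => -(v (δ + T - t) x)) (K := K)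
      (s := fun _ => univ) (a := δ) (b := T) (f := fun t => f (δ + T - t)) (g := fun t => g (δ + T - t))
      (fun t ht => ((hL _ (hm t ⟨ht.1, ht.2.le⟩).1).neg).lipschitzOnWith)
      (fun t ht => (hd f hf t ht).continuousAt.continuousWithinAt)
      (fun t ht => (hd f hf t ⟨ht.1, ht.2.le⟩).hasDerivWithinAt) (fun _ _ => trivial)
      (fun t ht => (hd g hg t ht).continuousAt.continuousWithinAt)
      (fun t ht => (hd g hg t ⟨ht.1, ht.2.le⟩).hasDerivWithinAt) (fun _ _ => trivial)
      le_rfl T ⟨hδT.le, le_rfl⟩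
    simp only [add_sub_cancel_right, add_sub_cancel_left, hf0, hg0, hfT, hgT, dist_eq_norm] at this
    rw [Real.exp_neg, inv_mul_le_iff₀ (Real.exp_pos _)]
    linarith
  · have := dist_le_of_trajectories_ODE_of_mem (v := v) (K := K)
      (s := fun _ => univ) (a := δ) (b := T) (f := f) (g := g)
      (fun t ht => (hL t ht.1).lipschitzOnWith)
      (fun t ht => (hf t ht).continuousAt.continuousWithinAt)
      (fun t ht => (hf t ⟨ht.1, ht.2.le⟩).hasDerivWithinAt) (fun _ _ => trivial)
      (fun t ht => (hg t ht).continuousAt.continuousWithinAt)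
      (fun t ht => (hg t ⟨ht.1, ht.2.le⟩).hasDerivWithinAt) (fun _ _ => trivial)
      le_rfl T ⟨hδT.le, le_rfl⟩
    simp only [hf0, hg0, hfT, hgT, dist_eq_norm] at this
    linarith

theorem gauss_nonneg {n : ℕ} {s : ℝ} (hs : 0 < s) (z : EuclideanSpace ℝ (Fin n)) :
    0 ≤ gaussKernel n s z := by unfold gaussKernel; positivity

theorem gauss_cont (n : ℕ) (s : ℝ) : Continuous (gaussKernel n s) := by
  unfold gaussKernel; fun_prop

theorem gauss_integrable (n : ℕ) {b : ℝ} (hb : 0 < b) :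
    Integrable (fun x : EuclideanSpace ℝ (Fin n) => Real.exp (-b * ‖x‖ ^ 2)) := by
  by_contra h
  have h1 := GaussianFourier.integral_rexp_neg_mul_sq_norm (V := EuclideanSpace ℝ (Fin n)) hb
  rw [integral_undef h] at h1
  have : 0 < (π / b) ^ (Module.finrank ℝ (EuclideanSpace ℝ (Fin n)) / 2 : ℝ) := by positivity
  linarith

theorem gauss_lintegral {n : ℕ} {s : ℝ} (hs : 0 < s) (c : EuclideanSpace ℝ (Fin n)) :
    ∫⁻ x, ENNReal.ofReal (gaussKernel n s (x - c)) = 1 := by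
  rw [lintegral_sub_right_eq_self (fun x => ENNReal.ofReal (gaussKernel n s x)) c]
  have e : gaussKernel n s = fun x : EuclideanSpace ℝ (Fin n) =>
      (2 * π * s) ^ (-(n : ℝ) / 2) * Real.exp (-(2 * s)⁻¹ * ‖x‖ ^ 2) := by
    ext x; unfold gaussKernel; congr 2; ring
  have hi : Integrable (gaussKernel n s) := by
    rw [e]; exact (gauss_integrable n (by positivity)).const_mul _
  rw [← ofReal_integral_eq_lintegral_ofReal hi (Eventually.of_forall fun z => gauss_nonneg hs z), e,
    integral_const_mul, GaussianFourier.integral_rexp_neg_mul_sq_norm (by positivity)]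
  rw [finrank_euclideanSpace_fin]
  have : π / (2 * s)⁻¹ = 2 * π * s := by field_simp
  rw [this, neg_div, Real.rpow_neg (by positivity), inv_mul_cancel₀ (by positivity)]
  simp

theorem contraction {n : ℕ} {h : EuclideanSpace ℝ (Fin n) → ℝ} (hh : Integrable h) (a : ℝ) {s : ℝ}
    (hs : 0 < s) :
    ∫⁻ x, ‖∫ y, h y * gaussKernel n s (x - a • y)‖ₑ ≤ ∫⁻ y, ‖h y‖ₑ := by
  calc ∫⁻ x, ‖∫ y, h y * gaussKernel n s (x - a • y)‖ₑ
      ≤ ∫⁻ x, ∫⁻ y, ‖h y‖ₑ * ENNReal.ofReal (gaussKernel n s (x - a • y)) := by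
        refine lintegral_mono fun x => (enorm_integral_le_lintegral_enorm _).trans (le_of_eq ?_)
        congr 1; ext y
        rw [enorm_mul, Real.enorm_eq_ofReal (gauss_nonneg hs _)]
    _ = ∫⁻ y, ∫⁻ x, ‖h y‖ₑ * ENNReal.ofReal (gaussKernel n s (x - a • y)) := by
        refine lintegral_lintegral_swap ?_
        refine AEMeasurable.mul hh.aestronglyMeasurable.enorm.comp_snd ?_
        have := gauss_cont n s
        exact Measurable.aemeasurable (Continuous.measurable (f := fun q : EuclideanSpace ℝ (Fin n) × EuclideanSpace ℝ (Fin n) => gaussKernel n s (q.1 - a • q.2)) (by fun_prop)).ennreal_ofReal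
    _ = ∫⁻ y, ‖h y‖ₑ := by
        congr 1; ext y
        rw [lintegral_const_mul', gauss_lintegral hs, mul_one]
        exact enorm_ne_top

theorem conv_subst {n : ℕ} (f : EuclideanSpace ℝ (Fin n) → ℝ) {a r : ℝ} (ha : 0 < a) (hr : 0 < r)
    (x : EuclideanSpace ℝ (Fin n)) :
    ∫ y, f y * gaussKernel n (r ^ 2) (x - a • y) =
      ∫ z, ((a ^ n)⁻¹ * f (a⁻¹ • (x - r • z))) * gaussKernel n 1 z := by
  have h1 := Measure.integral_comp_smul (volume : Measure (EuclideanSpace ℝ (Fin n)))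
    (fun w => f (a⁻¹ • w) * gaussKernel n (r ^ 2) (x - w)) a
  simp only [smul_smul, inv_mul_cancel₀ ha.ne', one_smul] at h1
  rw [h1, ← integral_sub_left_eq_self _ _ x]
  simp only [sub_sub_cancel]
  have h2 := Measure.integral_comp_smul (volume : Measure (EuclideanSpace ℝ (Fin n)))
    (fun w => f (a⁻¹ • (x - w)) * gaussKernel n (r ^ 2) w) r
  rw [finrank_euclideanSpace_fin] at *
  have h3 : ∫ w, f (a⁻¹ • (x - w)) * gaussKernel n (r ^ 2) w =
      r ^ n * ∫ w, f (a⁻¹ • (x - r • w)) * gaussKernel n (r ^ 2) (r • w) := by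
    rw [h2, abs_of_pos (by positivity), smul_eq_mul, ← mul_assoc, mul_inv_cancel₀ (by positivity), one_mul]
  rw [h3, smul_eq_mul, abs_of_pos (by positivity), ← integral_const_mul, ← integral_const_mul]
  congr 1; ext z
  have h4 : gaussKernel n 1 z = r ^ n * gaussKernel n (r ^ 2) (r • z) := by
    unfold gaussKernel
    rw [norm_smul, Real.norm_eq_abs, abs_of_pos hr, Real.mul_rpow (x := 2 * π) (y := r ^ 2) (by positivity) (by positivity),
      ← Real.rpow_natCast r 2, ← Real.rpow_mul hr.le]
    have e1 : ((2 : ℕ) : ℝ) * (-(n : ℝ) / 2) = -n := by push_cast; ring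
    rw [e1, Real.rpow_neg hr.le, Real.rpow_natCast]
    have e2 : -(r * ‖z‖) ^ 2 / (2 * r ^ ((2 : ℕ) : ℝ)) = -‖z‖ ^ 2 / (2 * 1) := by
      rw [Real.rpow_natCast]; field_simp
    rw [e2, mul_one, mul_one]
    field_simp
  rw [h4]; ring

theorem L1_scale {n : ℕ} (f : EuclideanSpace ℝ (Fin n) → ℝ) (hf : Continuous f) {a : ℝ} (ha : 0 < a)
    (c : EuclideanSpace ℝ (Fin n)) :
    ∫⁻ x, ‖(a ^ n)⁻¹ * f (a⁻¹ • (x - c))‖ₑ = ∫⁻ x, ‖f x‖ₑ := by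
  rw [lintegral_sub_right_eq_self (fun x => ‖(a ^ n)⁻¹ * f (a⁻¹ • x)‖ₑ) c]
  have hm := Measure.map_addHaar_smul (volume : Measure (EuclideanSpace ℝ (Fin n))) (inv_pos.2 ha).ne'
  have h1 : ∫⁻ x, ‖f (a⁻¹ • x)‖ₑ = ∫⁻ x, ‖f x‖ₑ ∂(Measure.map (a⁻¹ • ·) volume) :=
    (lintegral_map (f := fun x => ‖f x‖ₑ) hf.measurable.enorm (measurable_const_smul _)).symm
  simp_rw [enorm_mul]
  rw [lintegral_const_mul' _ _ enorm_ne_top, h1, hm, lintegral_smul_measure, finrank_euclideanSpace_fin,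
    Real.enorm_eq_ofReal (by positivity), abs_of_pos (by positivity), smul_eq_mul, ← mul_assoc,
    ← ENNReal.ofReal_mul (by positivity), inv_pow, inv_inv, inv_mul_cancel₀ (by positivity)]
  simp

theorem small_cont {n : ℕ} {f : EuclideanSpace ℝ (Fin n) → ℝ} (hf : Continuous f)
    (hc : HasCompactSupport f) (hfi : Integrable f) :
    Tendsto (fun t : ℝ => ∫⁻ x, ‖(∫ y, f y * gaussKernel n (1 - Real.exp (-t)) (x - Real.exp (-t / 2) • y)) - f x‖ₑ)
      (𝓝[>] 0) (𝓝 0) := by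
  set a : ℝ → ℝ := fun t => Real.exp (-t / 2) with ha
  set r : ℝ → ℝ := fun t => √(1 - Real.exp (-t)) with hr
  have hac : Continuous a := by fun_prop
  have hrc : Continuous r := by fun_prop
  have ha0 : ∀ t, 0 < a t := fun t => Real.exp_pos _
  have hpos : ∀ t, 0 < t → 0 < 1 - Real.exp (-t) := fun t ht => by
    have : Real.exp (-t) < 1 := by simpa using ht
    linarith
  have hr0 : ∀ t, 0 < t → 0 < r t := fun t ht => Real.sqrt_pos.2 (hpos t ht)
  set H : ℝ → EuclideanSpace ℝ (Fin n) → EuclideanSpace ℝ (Fin n) → ℝ :=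
    fun t z x => (a t ^ n)⁻¹ * f ((a t)⁻¹ • (x - r t • z)) - f x with hH
  have hHc : ∀ t, Continuous (fun q : EuclideanSpace ℝ (Fin n) × EuclideanSpace ℝ (Fin n) => H t q.1 q.2) := by
    intro t; fun_prop
  have hG := gauss_cont n 1
  have hgi : Integrable (gaussKernel n 1) := by
    refine ⟨hG.aestronglyMeasurable, ?_⟩
    have := gauss_lintegral (n := n) one_pos 0
    simp only [sub_zero] at this
    rw [HasFiniteIntegral]
    simp_rw [fun x => Real.enorm_eq_ofReal (gauss_nonneg (n := n) one_pos x)]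
    rw [this]; exact ENNReal.one_lt_top
  have hg1 : ∫ z, gaussKernel n 1 z = 1 := by
    rw [integral_eq_lintegral_of_nonneg_ae (Eventually.of_forall fun z => gauss_nonneg one_pos z)
      hG.aestronglyMeasurable]
    have := gauss_lintegral (n := n) one_pos 0
    simp only [sub_zero] at this
    simp [this]
  obtain ⟨M, hM⟩ := hc.exists_bound_of_continuous hf
  -- main bound
  have hbound : ∀ t, 0 < t → ∫⁻ x, ‖(∫ y, f y * gaussKernel n (1 - Real.exp (-t)) (x - Real.exp (-t / 2) • y)) - f x‖ₑ
      ≤ ∫⁻ z, (∫⁻ x, ‖H t z x‖ₑ) * ENNReal.ofReal (gaussKernel n 1 z) := by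
    intro t ht
    have e1 : ∀ x, (∫ y, f y * gaussKernel n (1 - Real.exp (-t)) (x - Real.exp (-t / 2) • y)) - f x =
        ∫ z, H t z x * gaussKernel n 1 z := by
      intro x
      have := conv_subst f (ha0 t) (hr0 t ht) x
      rw [show r t ^ 2 = 1 - Real.exp (-t) from Real.sq_sqrt (hpos t ht).le] at this
      rw [this]
      have e2 : f x = ∫ z, f x * gaussKernel n 1 z := by rw [integral_const_mul, hg1, mul_one]
      conv_lhs => rw [e2]
      rw [← integral_sub]
      · simp only [hH, sub_mul]
      · refine hgi.bdd_mul (c := ‖(a t ^ n)⁻¹‖ * M) ?_ (Eventually.of_forall fun z => ?_)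
        · exact Continuous.aestronglyMeasurable (by fun_prop)
        · rw [norm_mul]; exact mul_le_mul_of_nonneg_left (hM _) (norm_nonneg _)
      · exact hgi.const_mul _
    simp_rw [e1]
    calc ∫⁻ x, ‖∫ z, H t z x * gaussKernel n 1 z‖ₑ 
        ≤ ∫⁻ x, ∫⁻ z, ‖H t z x‖ₑ * ENNReal.ofReal (gaussKernel n 1 z) := by
          refine lintegral_mono fun x => (enorm_integral_le_lintegral_enorm _).trans (le_of_eq ?_)
          congr 1; ext y
          rw [enorm_mul, Real.enorm_eq_ofReal (gauss_nonneg one_pos _)]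
      _ = ∫⁻ z, ∫⁻ x, ‖H t z x‖ₑ * ENNReal.ofReal (gaussKernel n 1 z) := by
          refine lintegral_lintegral_swap ?_
          exact AEMeasurable.mul ((hHc t).comp continuous_swap).measurable.enorm.aemeasurable (hG.comp continuous_snd).measurable.ennreal_ofReal.aemeasurable
      _ = _ := by
          congr 1; ext z
          rw [lintegral_mul_const' _ _ ENNReal.ofReal_ne_top]
  -- inner limit
  obtain ⟨R, hR0, hR⟩ : ∃ R, 0 ≤ R ∧ ∀ y, R < ‖y‖ → f y = 0 := by
    obtain ⟨R, hR⟩ := hc.isCompact.isBounded.subset_closedBall 0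
    refine ⟨max R 0, le_max_right _ _, fun y hy => ?_⟩
    by_contra h
    have := hR (subset_tsupport f h)
    simp at this
    linarith [le_max_left R 0]
  have ha2 : ∀ᶠ t in 𝓝[>] (0 : ℝ), (a t ^ n)⁻¹ ≤ 2 := by
    have : Tendsto (fun t => (a t ^ n)⁻¹) (𝓝[>] 0) (𝓝 ((a 0 ^ n)⁻¹)) :=
      ((hac.pow n).inv₀ (fun t => (pow_pos (ha0 t) n).ne')).continuousAt.tendsto.mono_left nhdsWithin_le_nhds
    refine this.eventually_le_const ?_
    simp [ha]
  have hinner : ∀ z, Tendsto (fun t => ∫⁻ x, ‖H t z x‖ₑ) (𝓝[>] 0) (𝓝 0) := by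
    intro z
    have := tendsto_lintegral_filter_of_dominated_convergence (μ := volume) (l := 𝓝[>] (0 : ℝ))
      (F := fun t x => ‖H t z x‖ₑ) (f := fun _ => 0)
      ((Metric.closedBall (0 : EuclideanSpace ℝ (Fin n)) (R + ‖z‖)).indicator
        fun _ => ENNReal.ofReal (3 * M)) ?_ ?_ ?_ ?_
    · simpa using this
    · exact Eventually.of_forall fun t => Continuous.measurable (by fun_prop)
    · filter_upwards [ha2, self_mem_nhdsWithin] with t ht2 ht
      have ht : 0 < t := ht
      refine Eventually.of_forall fun x => ?_
      by_cases hx : x ∈ Metric.closedBall (0 : EuclideanSpace ℝ (Fin n)) (R + ‖z‖)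
      · rw [indicator_of_mem hx, ← ofReal_norm]
        refine ENNReal.ofReal_le_ofReal ?_
        refine (norm_sub_le _ _).trans ?_
        rw [norm_mul, Real.norm_eq_abs, abs_of_pos (by have := ha0 t; positivity)]
        have h1 := hM x
        have h2 := hM ((a t)⁻¹ • (x - r t • z))
        have := mul_le_mul ht2 h2 (norm_nonneg _) (by norm_num)
        linarith
      · rw [indicator_of_notMem hx]
        have hx : R + ‖z‖ < ‖x‖ := by simpa using hx
        have ha1 : a t ≤ 1 := Real.exp_le_one_iff.2 (by linarith)
        have hr1 : r t ≤ 1 := by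
          exact Real.sqrt_le_one.2 (by linarith [Real.exp_pos (-t)])
        have h1 : f x = 0 := hR x (by linarith [norm_nonneg z])
        have h2 : f ((a t)⁻¹ • (x - r t • z)) = 0 := by
          apply hR
          rw [norm_smul, Real.norm_eq_abs, abs_of_pos (inv_pos.2 (ha0 t)), lt_inv_mul_iff₀ (ha0 t)]
          have h3 : ‖x‖ - ‖r t • z‖ ≤ ‖x - r t • z‖ := norm_sub_norm_le _ _
          rw [norm_smul, Real.norm_eq_abs, abs_of_pos (hr0 t ht)] at h3
          have h4 : r t * ‖z‖ ≤ 1 * ‖z‖ := mul_le_mul_of_nonneg_right hr1 (norm_nonneg _)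
          have h5 : a t * R ≤ 1 * R := mul_le_mul_of_nonneg_right ha1 hR0
          linarith
        simp [hH, h1, h2]
    · rw [lintegral_indicator measurableSet_closedBall, setLIntegral_const]
      exact ENNReal.mul_ne_top ENNReal.ofReal_ne_top measure_closedBall_lt_top.ne
    · refine Eventually.of_forall fun x => ?_
      have hcont : Continuous (fun t => ‖H t z x‖ₑ) := by
        have h1 : Continuous fun t => (a t ^ n)⁻¹ := (hac.pow n).inv₀ (fun t => (pow_pos (ha0 t) n).ne')
        have h2 : Continuous fun t => (a t)⁻¹ := hac.inv₀ (fun t => (ha0 t).ne')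
        fun_prop
      have := hcont.tendsto 0
      have h0 : ‖H 0 z x‖ₑ = 0 := by simp [hH, ha, hr]
      rw [h0] at this
      exact this.mono_left nhdsWithin_le_nhds
  have houter : Tendsto (fun t => ∫⁻ z, (∫⁻ x, ‖H t z x‖ₑ) * ENNReal.ofReal (gaussKernel n 1 z)) (𝓝[>] 0) (𝓝 0) := by
    have := tendsto_lintegral_filter_of_dominated_convergence (μ := volume) (l := 𝓝[>] (0 : ℝ))
      (F := fun t z => (∫⁻ x, ‖H t z x‖ₑ) * ENNReal.ofReal (gaussKernel n 1 z)) (f := fun _ => 0)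
      (fun z => (2 * ∫⁻ x, ‖f x‖ₑ) * ENNReal.ofReal (gaussKernel n 1 z)) ?_ ?_ ?_ ?_
    · simpa using this
    · refine Eventually.of_forall fun t => Measurable.mul ?_ hG.measurable.ennreal_ofReal
      exact Measurable.lintegral_prod_right' (f := fun q : EuclideanSpace ℝ (Fin n) × EuclideanSpace ℝ (Fin n) => ‖H t q.1 q.2‖ₑ)
        (hHc t).measurable.enorm
    · refine Eventually.of_forall fun t => Eventually.of_forall fun z => ?_
      gcongr
      calc ∫⁻ x, ‖H t z x‖ₑ ≤ ∫⁻ x, (‖(a t ^ n)⁻¹ * f ((a t)⁻¹ • (x - r t • z))‖ₑ + ‖f x‖ₑ) :=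
            lintegral_mono fun x => enorm_sub_le
        _ = _ := by
          rw [lintegral_add_right _ hf.measurable.enorm, L1_scale f hf (ha0 t), two_mul]
    · have h1 := gauss_lintegral (n := n) one_pos 0
      simp only [sub_zero] at h1
      have h2 : ∫⁻ x, ‖f x‖ₑ < ∞ := hfi.2
      have h3 : (2 * ∫⁻ x, ‖f x‖ₑ) ≠ ∞ := ENNReal.mul_ne_top ENNReal.ofNat_ne_top h2.ne
      rw [lintegral_const_mul' _ _ h3, h1, mul_one]
      exact h3
    · refine Eventually.of_forall fun z => ?_
      have := ENNReal.Tendsto.mul_const (b := ENNReal.ofReal (gaussKernel n 1 z)) (hinner z) (Or.inr ENNReal.ofReal_ne_top)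
      simpa using this
  refine tendsto_of_tendsto_of_tendsto_of_le_of_le' tendsto_const_nhds houter
    (Eventually.of_forall fun _ => zero_le) ?_
  filter_upwards [self_mem_nhdsWithin] with t ht using hbound t ht

theorem small_pH {n : ℕ} {pH : EuclideanSpace ℝ (Fin n) → ℝ} (hint : Integrable pH)
    (hc : HasCompactSupport pH) {ε : ℝ≥0∞} (hε : 0 < ε) :
    ∃ t : ℝ, 0 < t ∧ ∫⁻ x, ‖(∫ y, pH y * gaussKernel n (1 - Real.exp (-t)) (x - Real.exp (-t / 2) • y)) - pH x‖ₑ ≤ ε := by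
  have hε3 : 0 < ε / 3 := ENNReal.div_pos hε.ne' (by norm_num)
  obtain ⟨f, hfc, hfe, hf, hfi⟩ := hint.exists_hasCompactSupport_lintegral_sub_le hε3.ne'
  have hev := (small_cont hf hfc hfi).eventually (gt_mem_nhds hε3)
  obtain ⟨t, ht, ht0⟩ := (hev.and self_mem_nhdsWithin).exists
  have ht0 : 0 < t := ht0
  refine ⟨t, ht0, ?_⟩
  have hs : 0 < 1 - Real.exp (-t) := by
    have : Real.exp (-t) < 1 := by simpa using ht0
    linarith
  generalize 1 - Real.exp (-t) = s at *
  generalize Real.exp (-t / 2) = a at *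
  have hsup : ∀ f : EuclideanSpace ℝ (Fin n) → ℝ, HasCompactSupport f → ∃ R, ∀ y, R < ‖y‖ → f y = 0 := by
    intro f hc
    obtain ⟨R, hR⟩ := hc.isCompact.isBounded.subset_closedBall 0
    refine ⟨R, fun y hy => ?_⟩
    by_contra h
    have := hR (subset_tsupport f h)
    simp at this
    linarith
  obtain ⟨R1, hR1⟩ := hsup pH hc
  obtain ⟨R2, hR2⟩ := hsup f hfc
  have hG := gauss_cont n s
  have e : ∀ x, ‖(∫ y, pH y * gaussKernel n s (x - a • y)) - pH x‖ₑ ≤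
      (‖∫ y, (pH y - f y) * gaussKernel n s (x - a • y)‖ₑ +
      ‖(∫ y, f y * gaussKernel n s (x - a • y)) - f x‖ₑ) + ‖pH x - f x‖ₑ := by
    intro x
    have i1 := aux_integrable_s9 hint hR1 (g := fun y => gaussKernel n s (x - a • y)) (by fun_prop)
    have i2 := aux_integrable_s9 hfi hR2 (g := fun y => gaussKernel n s (x - a • y)) (by fun_prop)
    simp only [smul_eq_mul] at i1 i2
    have : (∫ y, (pH y - f y) * gaussKernel n s (x - a • y)) =
      (∫ y, pH y * gaussKernel n s (x - a • y)) - ∫ y, f y * gaussKernel n s (x - a • y) := by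
      simp_rw [sub_mul]
      exact integral_sub i1 i2
    rw [this]
    refine le_trans (le_of_eq ?_) (enorm_sub_le.trans (add_le_add_left (enorm_add_le _ _) _))
    congr 1; ring
  refine (lintegral_mono e).trans ?_
  have hm : AEMeasurable (fun x => ‖pH x - f x‖ₑ) := (hint.sub hfi).aestronglyMeasurable.enorm
  rw [lintegral_add_right' _ hm, lintegral_add_right' _ ?_]
  · refine (add_le_add (add_le_add ((contraction (hint.sub hfi) a hs).trans hfe) ht.le) hfe).trans (le_of_eq ?_)
    exact ENNReal.add_thirds ε
  · exact ((conv_cont hfi hR2 a hs).sub hf).measurable.enorm.aemeasurable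

theorem gauss_bd {n : ℕ} {a s R : ℝ} (ha0 : 0 ≤ a) (ha : a ≤ 1) (hs : 1 / 2 ≤ s) (hs1 : s ≤ 1) 
    (x y : EuclideanSpace ℝ (Fin n)) (hy : ‖y‖ ≤ R) :
    gaussKernel n s (x - a • y) ≤ π ^ (-(n : ℝ) / 2) * Real.exp (R ^ 2 / 2) * Real.exp (-(1 / 4) * ‖x‖ ^ 2) := by
  unfold gaussKernel
  rw [mul_assoc (π ^ (-(n : ℝ) / 2)), ← Real.exp_add]
  refine mul_le_mul ?_ (Real.exp_le_exp.2 ?_) (Real.exp_pos _).le (by positivity)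
  · refine Real.rpow_le_rpow_of_nonpos Real.pi_pos ?_ ?_
    · nlinarith [Real.pi_pos]
    · have : (0 : ℝ) ≤ n := Nat.cast_nonneg n
      linarith
  · have h1 : ‖x‖ ≤ ‖x - a • y‖ + ‖a • y‖ := by
      simpa using norm_add_le (x - a • y) (a • y)
    have h2 : ‖a • y‖ ≤ R := by
      rw [norm_smul, Real.norm_eq_abs, abs_of_nonneg ha0]
      nlinarith [norm_nonneg y]
    have h3 : -‖x - a • y‖ ^ 2 / (2 * s) ≤ -‖x - a • y‖ ^ 2 / 2 := by
      rw [neg_div, neg_div, neg_le_neg_iff]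
      apply div_le_div_of_nonneg_left (by positivity) (by linarith) (by linarith)
    have h4 : ‖x‖ ^ 2 ≤ (‖x - a • y‖ + R) ^ 2 := by
      apply pow_le_pow_left₀ (norm_nonneg _); linarith
    nlinarith [sq_nonneg (‖x - a • y‖ - R)]

theorem large_pH {n : ℕ} {pH : EuclideanSpace ℝ (Fin n) → ℝ} (hint : Integrable pH)
    (hnn : ∀ x, 0 ≤ pH x) (hmass : ∫ x, pH x = 1) {R : ℝ} (hR : ∀ y, R < ‖y‖ → pH y = 0) :
    Tendsto (fun t : ℝ => ∫⁻ x, ‖(∫ y, pH y * gaussKernel n (1 - Real.exp (-t)) (x - Real.exp (-t / 2) • y)) - gaussKernel n 1 x‖ₑ)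
      atTop (𝓝 0) := by
  have hlim1 : Tendsto (fun t : ℝ => 1 - Real.exp (-t)) atTop (𝓝 1) := by
    simpa using Real.tendsto_exp_neg_atTop_nhds_zero.const_sub 1
  have hlim2 : Tendsto (fun t : ℝ => Real.exp (-t / 2)) atTop (𝓝 0) := by
    refine Real.tendsto_exp_atBot.comp ?_
    exact (tendsto_neg_atTop_atBot).atBot_div_const (by norm_num)
  have hev : ∀ᶠ t : ℝ in atTop, 1 / 2 ≤ 1 - Real.exp (-t) ∧ 0 ≤ t :=
    (hlim1.eventually_const_le (by norm_num)).and (eventually_ge_atTop 0)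
  have hb : ∀ᶠ t : ℝ in atTop, ∀ x y, ‖pH y * gaussKernel n (1 - Real.exp (-t)) (x - Real.exp (-t / 2) • y)‖ ≤
      pH y * (π ^ (-(n : ℝ) / 2) * Real.exp (R ^ 2 / 2) * Real.exp (-(1 / 4) * ‖x‖ ^ 2)) := by
    filter_upwards [hev] with t ⟨ht, ht0⟩ x y
    by_cases h : R < ‖y‖
    · simp [hR y h]
    push Not at h
    rw [Real.norm_eq_abs, abs_of_nonneg (mul_nonneg (hnn y) (gauss_nonneg (by linarith) _))]
    refine mul_le_mul_of_nonneg_left ?_ (hnn y)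
    exact gauss_bd (Real.exp_pos _).le (Real.exp_le_one_iff.2 (by linarith)) ht (by linarith [Real.exp_pos (-t)]) x y h
  have hG1 := gauss_cont n 1
  have hgi : Integrable (gaussKernel n 1) := by
    refine ⟨hG1.aestronglyMeasurable, ?_⟩
    have := gauss_lintegral (n := n) one_pos 0
    simp only [sub_zero] at this
    rw [HasFiniteIntegral]
    simp_rw [fun x => Real.enorm_eq_ofReal (gauss_nonneg (n := n) one_pos x)]
    rw [this]; exact ENNReal.one_lt_top
  have := tendsto_lintegral_filter_of_dominated_convergence (μ := volume) (l := (atTop : Filter ℝ))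
    (F := fun t x => ‖(∫ y, pH y * gaussKernel n (1 - Real.exp (-t)) (x - Real.exp (-t / 2) • y)) - gaussKernel n 1 x‖ₑ)
    (f := fun _ => 0)
    (fun x => ‖π ^ (-(n : ℝ) / 2) * Real.exp (R ^ 2 / 2) * Real.exp (-(1 / 4) * ‖x‖ ^ 2)
      + gaussKernel n 1 x‖ₑ) ?_ ?_ ?_ ?_
  · simpa using this
  · filter_upwards [hev] with t ht
    exact ((conv_cont hint hR _ (by linarith)).sub hG1).measurable.enorm
  · filter_upwards [hb] with t ht
    refine Eventually.of_forall fun x => ?_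
    rw [← ofReal_norm, ← ofReal_norm]
    refine ENNReal.ofReal_le_ofReal ?_
    have h0 := gauss_nonneg (n := n) one_pos x
    rw [Real.norm_of_nonneg (r := _ + _) (by positivity)]
    refine (norm_sub_le _ _).trans (add_le_add ?_ (by rw [Real.norm_of_nonneg h0]))
    have h1 := norm_integral_le_of_norm_le (hint.mul_const _) (Eventually.of_forall (ht x))
    rwa [integral_mul_const, hmass, one_mul] at h1
  · exact ((((gauss_integrable n (by norm_num)).const_mul _).add hgi).2).ne
  · refine Eventually.of_forall fun x => ?_
    have h1 : Tendsto (fun t : ℝ => ∫ y, pH y * gaussKernel n (1 - Real.exp (-t)) (x - Real.exp (-t / 2) • y)) atTop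
        (𝓝 (∫ y, pH y * gaussKernel n 1 x)) := by
      refine tendsto_integral_filter_of_dominated_convergence _ ?_ (hb.mono fun t ht => Eventually.of_forall (ht x))
        (hint.mul_const _) (Eventually.of_forall fun y => ?_)
      · refine Eventually.of_forall fun t => ?_
        have := gauss_cont n (1 - Real.exp (-t))
        exact (aux_integrable_s9 hint hR (g := fun y => gaussKernel n (1 - Real.exp (-t)) (x - Real.exp (-t / 2) • y)) (by fun_prop)).aestronglyMeasurable
      · refine Tendsto.const_mul _ ?_
        have hz : Tendsto (fun t : ℝ => x - Real.exp (-t / 2) • y) atTop (𝓝 x) := by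
          simpa using (hlim2.smul_const y).const_sub x
        unfold gaussKernel
        refine Tendsto.mul ?_ ?_
        · exact (hlim1.const_mul (2 * π)).rpow_const (Or.inl (by positivity))
        · exact (Real.continuous_exp.tendsto _).comp (((hz.norm.pow 2).neg).div (hlim1.const_mul 2) (by norm_num))
    rw [integral_mul_const, hmass, one_mul] at h1
    have h2 := (continuous_enorm.tendsto _).comp (h1.sub_const (gaussKernel n 1 x))
    simpa [Function.comp_def] using h2

theorem dens_le {n : ℕ} {p q : EuclideanSpace ℝ (Fin n) → ℝ} (hp : AEStronglyMeasurable p)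
    (hq : AEStronglyMeasurable q) {s : Set (EuclideanSpace ℝ (Fin n))} (hs : MeasurableSet s) :
    densMeasure n p s ≤ densMeasure n q s + ∫⁻ x, ‖p x - q x‖ₑ := by
  unfold densMeasure
  rw [withDensity_apply _ hs, withDensity_apply _ hs]
  calc ∫⁻ x in s, ENNReal.ofReal (p x) ≤ ∫⁻ x in s, (ENNReal.ofReal (q x) + ‖p x - q x‖ₑ) := by
        refine lintegral_mono fun x => ?_
        have : p x = q x + (p x - q x) := by ring
        conv_lhs => rw [this]
        exact ENNReal.ofReal_add_le.trans (add_le_add_right (Real.ofReal_le_enorm _) _)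
    _ = (∫⁻ x in s, ENNReal.ofReal (q x)) + ∫⁻ x in s, ‖p x - q x‖ₑ :=
        lintegral_add_right' _ (hp.sub hq).enorm.restrict
    _ ≤ _ := add_le_add le_rfl (setLIntegral_le_lintegral _ _)

end Aux

/-- Corollary (compactly supported targets): for every `ε > 0` there are `0 < δ < T` such that
every bijective flow map of the VP probability flow from `δ` to `T` transporting `p_δ` to
`p_T` is bi-Lipschitz, and its Gaussian pullback is `ε`-close to `p_H` in total variation. -/
theorem stmt_9 (n : ℕ) (pH : EuclideanSpace ℝ (Fin n) → ℝ)
    (hnn : ∀ x, 0 ≤ pH x) (hint : Integrable pH) (hmass : ∫ x, pH x = 1)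
    (hsupp : HasCompactSupport pH) :
    ∀ ε : ℝ≥0∞, 0 < ε → ∃ δ T : ℝ, 0 < δ ∧ δ < T ∧
      ∀ φ : EuclideanSpace ℝ (Fin n) → EuclideanSpace ℝ (Fin n),
        Function.Bijective φ →
        IsFlowMap n (vField n pH) δ T φ →
        Measure.map φ (densMeasure n (vpMarginal n pH δ)) =
          densMeasure n (vpMarginal n pH T) →
        BiLipschitz φ ∧
          tvDist (densMeasure n pH)
            (Measure.map (Function.invFun φ) (stdGaussian n)) < ε := by
  intro ε hε
  obtain ⟨r, hr0, hrε⟩ := ENNReal.lt_iff_exists_nnreal_btwn.1 hε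
  have he : 0 < (r : ℝ≥0∞) / 4 := ENNReal.div_pos hr0.ne' (by norm_num)
  obtain ⟨R, hR0, hR⟩ : ∃ R, 0 ≤ R ∧ ∀ y, R < ‖y‖ → pH y = 0 := by
    obtain ⟨R, hR⟩ := hsupp.isCompact.isBounded.subset_closedBall 0
    refine ⟨max R 0, le_max_right _ _, fun y hy => ?_⟩
    by_contra h
    have := hR (subset_tsupport pH h)
    simp at this
    linarith [le_max_left R 0]
  obtain ⟨δ, hδ, hD1⟩ := small_pH hint hsupp he
  obtain ⟨T, hD2, hT⟩ := (((large_pH hint hnn hmass hR).eventually (gt_mem_nhds he)).and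
    (eventually_gt_atTop δ)).exists
  have hsδ : 0 < 1 - Real.exp (-δ) := by
    have : Real.exp (-δ) < 1 := by simpa using hδ
    linarith
  have hsT : 0 < 1 - Real.exp (-T) := by
    have : Real.exp (-T) < 1 := by simpa using hδ.trans hT
    linarith
  refine ⟨δ, T, hδ, hT, fun φ hbij hflow hmap => ?_⟩
  have hbl : BiLipschitz φ :=
    flow_bilip hT (by positivity)
      (fun t ht x x' => score_lip hint hR0 hR hnn (by rw [hmass]; exact one_pos) hδ ht x x') hflow
  refine ⟨hbl, ?_⟩
  obtain ⟨c, C, hc, hcC, hcx⟩ := hbl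
  have hφc : Continuous φ :=
    (LipschitzWith.of_dist_le_mul (K := C.toNNReal) fun x y => by
      rw [Real.coe_toNNReal C (by linarith)]
      simpa [dist_eq_norm] using (hcx x y).2).continuous
  have hr1 : ∀ x, φ (Function.invFun φ x) = x := Function.rightInverse_invFun hbij.2
  have hl1 : ∀ x, Function.invFun φ (φ x) = x := Function.leftInverse_invFun hbij.1
  have hψc : Continuous (Function.invFun φ) :=
    (LipschitzWith.of_dist_le_mul (K := c⁻¹.toNNReal) fun x y => by
      have := (hcx (Function.invFun φ x) (Function.invFun φ y)).1
      rw [hr1, hr1] at this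
      rw [Real.coe_toNNReal _ (by positivity), dist_eq_norm, dist_eq_norm]
      rw [inv_mul_eq_div, le_div_iff₀ hc]
      linarith).continuous
  have hpδ : vpMarginal n pH δ = fun x => ∫ y, pH y * gaussKernel n (1 - Real.exp (-δ)) (x - Real.exp (-δ / 2) • y) := by
    ext x; simp [vpMarginal, hδ.ne']
  have hpT : vpMarginal n pH T = fun x => ∫ y, pH y * gaussKernel n (1 - Real.exp (-T)) (x - Real.exp (-T / 2) • y) := by
    ext x; simp [vpMarginal, (hδ.trans hT).ne']
  have mδ : AEStronglyMeasurable (vpMarginal n pH δ) := by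
    rw [hpδ]; exact (conv_cont hint hR _ hsδ).aestronglyMeasurable
  have mT : AEStronglyMeasurable (vpMarginal n pH T) := by
    rw [hpT]; exact (conv_cont hint hR _ hsT).aestronglyMeasurable
  have mG : AEStronglyMeasurable (gaussKernel n 1) := (gauss_cont n 1).aestronglyMeasurable
  have mH := hint.aestronglyMeasurable
  have d1 : ∫⁻ x, ‖vpMarginal n pH δ x - pH x‖ₑ ≤ r / 4 := by rw [hpδ]; exact hD1
  have d1' : ∫⁻ x, ‖pH x - vpMarginal n pH δ x‖ₑ ≤ r / 4 := by simp_rw [enorm_sub_rev (pH _)]; exact d1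
  have d2 : ∫⁻ x, ‖vpMarginal n pH T x - gaussKernel n 1 x‖ₑ ≤ r / 4 := by rw [hpT]; exact hD2.le
  have d2' : ∫⁻ x, ‖gaussKernel n 1 x - vpMarginal n pH T x‖ₑ ≤ r / 4 := by
    simp_rw [enorm_sub_rev (gaussKernel n 1 _)]; exact d2
  have hkey : ∀ s, MeasurableSet s → densMeasure n (vpMarginal n pH T) (Function.invFun φ ⁻¹' s) =
      densMeasure n (vpMarginal n pH δ) s := by
    intro s hs
    rw [← hmap, Measure.map_apply hφc.measurable (hψc.measurable hs), ← preimage_comp]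
    congr 1
    ext x; simp [hl1]
  have b1 : (⨆ (s : Set (EuclideanSpace ℝ (Fin n))) (_ : MeasurableSet s), densMeasure n pH s -
      (Measure.map (Function.invFun φ) (stdGaussian n)) s) ≤ r / 4 + r / 4 := by
    refine iSup₂_le fun s hs => tsub_le_iff_left.2 ?_
    rw [Measure.map_apply hψc.measurable hs, ← add_assoc]
    refine (dens_le mH mδ hs).trans (add_le_add ?_ d1')
    rw [← hkey s hs]
    exact (dens_le mT mG (hψc.measurable hs)).trans (add_le_add_right d2 _)
  have b2 : (⨆ (s : Set (EuclideanSpace ℝ (Fin n))) (_ : MeasurableSet s),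
      (Measure.map (Function.invFun φ) (stdGaussian n)) s - densMeasure n pH s) ≤ r / 4 + r / 4 := by
    refine iSup₂_le fun s hs => tsub_le_iff_left.2 ?_
    rw [Measure.map_apply hψc.measurable hs, ← add_assoc]
    refine (dens_le mG mT (hψc.measurable hs)).trans (add_le_add ?_ d2')
    rw [hkey s hs]
    exact (dens_le mδ mH hs).trans (add_le_add_right d1 _)
  refine lt_of_le_of_lt (add_le_add b1 b2) (lt_of_eq_of_lt ?_ hrε)
  have : (r : ℝ≥0∞) / 4 + r / 4 + (r / 4 + r / 4) = 4 * (r / 4) := by ring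
  rw [this]
  exact ENNReal.mul_div_cancel (by norm_num) (by norm_num)
end
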